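/- Let α, β ∈ (0,1). For c > 0 set γ̂ = (2c − √(4c² + 16α))/8 and I_sph(c,α) = γ̂ − (α/(2c))·log(1 − c/(2γ̂)). For c > 0, γ > c/2 and ν ≥ 0 set b = c/(4γ), I₁(c,γ,ν) = (e^{bν²/(1−2b)}/√(1−2b))·(1 + erf(√2·b·ν/√(1−2b))), I₂(c,γ,ν) = (e^{bν²/(1−2b)}/√(1−2b))·erfc(ν/√(2(1−2b))) + erf(ν/√2), and I_sec(c,β) = inf_{γ > c/2, ν ≥ 0} ( γ + (β/c)·log I₁(c,γ,ν) + ((1−β)/c)·log I₂(c,γ,ν) ). Assume there exists c > 0 with −c/2 + I_sec(c,β) + I_sph(c,α) < 0. Then there exists ε > 0 such that for all sufficiently large n, with m = ⌈αn⌉, k = ⌈βn⌉, and A an m×n random matrix with i.i.d. standard normal entries, the probability is at least 1 − e^{−εn} that every x ∈ ℝ^n supported on the last k coordinates (x_i = 0 for i ≤ n−k) is the unique solution of the optimization problem: minimize ‖z‖₁ subject to Az = Ax. -/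

import Mathlib

open MeasureTheory ProbabilityTheory

/-- The standard error function `erf x = (2/√π) ∫₀ˣ e^{−t²} dt`. -/
noncomputable def erf (x : ℝ) : ℝ :=
  (2 / Real.sqrt Real.pi) * ∫ t in (0 : ℝ)..x, Real.exp (-t ^ 2)

/-- The complementary error function. -/
noncomputable def erfc (x : ℝ) : ℝ := 1 - erf x

/-- The spherical exponent `I_sph(c,α) = γ̂ − (α/(2c))·log(1 − c/(2γ̂))` with
`γ̂ = (2c − √(4c² + 16α))/8`. -/
noncomputable def Isph (c α : ℝ) : ℝ :=
  (2 * c - Real.sqrt (4 * c ^ 2 + 16 * α)) / 8 -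
    (α / (2 * c)) * Real.log
      (1 - c / (2 * ((2 * c - Real.sqrt (4 * c ^ 2 + 16 * α)) / 8)))

/-- `I₁(c,γ,ν)` with `b = c/(4γ)`. -/
noncomputable def I1 (c γ ν : ℝ) : ℝ :=
  (Real.exp ((c / (4 * γ)) * ν ^ 2 / (1 - 2 * (c / (4 * γ)))) /
      Real.sqrt (1 - 2 * (c / (4 * γ)))) *
    (1 + erf (Real.sqrt 2 * (c / (4 * γ)) * ν / Real.sqrt (1 - 2 * (c / (4 * γ)))))

/-- `I₂(c,γ,ν)` with `b = c/(4γ)`. -/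
noncomputable def I2 (c γ ν : ℝ) : ℝ :=
  (Real.exp ((c / (4 * γ)) * ν ^ 2 / (1 - 2 * (c / (4 * γ)))) /
      Real.sqrt (1 - 2 * (c / (4 * γ)))) *
    erfc (ν / Real.sqrt (2 * (1 - 2 * (c / (4 * γ))))) + erf (ν / Real.sqrt 2)

/-- `I_sec(c,β)`: infimum over `γ > c/2` and `ν ≥ 0`. -/
noncomputable def Isec (c β : ℝ) : ℝ :=
  sInf {v : ℝ | ∃ γ ν : ℝ, c / 2 < γ ∧ 0 ≤ ν ∧
    v = γ + (β / c) * Real.log (I1 c γ ν) + ((1 - β) / c) * Real.log (I2 c γ ν)}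

/-- `x` is the unique minimizer of `‖z‖₁` subject to `Az = Ax`. -/
def UniqueL1Min {m n : ℕ} (A : Fin m → Fin n → ℝ) (x : Fin n → ℝ) : Prop :=
  ∀ z : Fin n → ℝ, (∀ i, ∑ j, A i j * z j = ∑ j, A i j * x j) → z ≠ x →
    ∑ i, |x i| < ∑ i, |z i|

/-- The law of an `m × n` matrix with i.i.d. standard normal entries. -/
noncomputable def matrixGaussian (m n : ℕ) : Measure (Fin m → Fin n → ℝ) :=
  Measure.pi fun _ => Measure.pi fun _ => gaussianReal 0 1

local notation "γ₁" => gaussianReal 0 1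


lemma gpdf_eq (x : ℝ) : gaussianPDFReal 0 1 x = (Real.sqrt (2 * Real.pi))⁻¹ * Real.exp (-x ^ 2 / 2) := by
  simp [gaussianPDFReal_def]

lemma gpdf_deriv (x : ℝ) : HasDerivAt (gaussianPDFReal 0 1) (-x * gaussianPDFReal 0 1 x) x := by
  have : gaussianPDFReal 0 1 = fun x => (Real.sqrt (2 * Real.pi))⁻¹ * Real.exp (-x ^ 2 / 2) :=
    funext gpdf_eq
  rw [this]
  have h : HasDerivAt (fun x : ℝ => -x ^ 2 / 2) (-x) x := by
    have := ((hasDerivAt_id' x).pow 2).neg.div_const 2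
    refine this.congr_deriv ?_
    simp
    ring
  refine (h.exp.const_mul (Real.sqrt (2 * Real.pi))⁻¹).congr_deriv ?_
  ring

lemma integrable_id_g : Integrable (fun x : ℝ => x) γ₁ :=
  (memLp_id_gaussianReal (μ := 0) (v := 1) 1).integrable (by simp)

lemma integrable_gauss_iff (f : ℝ → ℝ) :
    Integrable f γ₁ ↔ Integrable (fun x => gaussianPDFReal 0 1 x * f x) := by
  rw [gaussianReal_of_var_ne_zero 0 (by norm_num : (1 : NNReal) ≠ 0)]
  rw [integrable_withDensity_iff_integrable_smul₀' (by fun_prop)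
    (Filter.Eventually.of_forall fun x => gaussianPDF_lt_top)]
  simp [toReal_gaussianPDF]

lemma stein1 (f f' : ℝ → ℝ) (C : ℝ) (hf : ∀ x, HasDerivAt f (f' x) x) (hc : Continuous f')
    (hb : ∀ x, |f x| ≤ C) (hb' : ∀ x, |f' x| ≤ C) :
    ∫ x, x * f x ∂γ₁ = ∫ x, f' x ∂γ₁ := by
  have hfc : Continuous f := continuous_iff_continuousAt.2 fun x => (hf x).continuousAt
  have i1 : Integrable f γ₁ := Integrable.of_bound hfc.aestronglyMeasurable C
    (Filter.Eventually.of_forall hb)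
  have i2 : Integrable f' γ₁ := Integrable.of_bound hc.aestronglyMeasurable C
    (Filter.Eventually.of_forall hb')
  have i3 : Integrable (fun x => x * f x) γ₁ :=
    integrable_id_g.mul_bdd (c := C) hfc.aestronglyMeasurable (Filter.Eventually.of_forall hb)
  rw [integral_gaussianReal_eq_integral_smul (by norm_num),
    integral_gaussianReal_eq_integral_smul (by norm_num)]
  rw [integrable_gauss_iff] at i1 i2 i3
  have := integral_mul_deriv_eq_deriv_mul_of_integrable (u := f) (u' := f')
    (v := gaussianPDFReal 0 1) (v' := fun x => -x * gaussianPDFReal 0 1 x)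
    (fun x _ => hf x) (fun x _ => gpdf_deriv x) (by
      convert i3.neg using 1; ext x; simp; ring) (by convert i2 using 1; ext x; simp; ring)
      (by convert i1 using 1; ext x; simp; ring)
  have e : ∫ x, gaussianPDFReal 0 1 x • (x * f x) = - ∫ x, f x * (-x * gaussianPDFReal 0 1 x) := by
    rw [← integral_neg]; congr 1; ext x; simp; ring
  rw [e, this]; simp [mul_comm]

lemma update_mp {κ : Type*} [Fintype κ] [DecidableEq κ] (μ : Measure ℝ) [IsProbabilityMeasure μ] (k : κ) :
    MeasurePreserving (fun p : (κ → ℝ) × ℝ => Function.update p.1 k p.2)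
      ((Measure.pi fun _ : κ => μ).prod μ) (Measure.pi fun _ : κ => μ) := by
  have hm : Measurable (fun p : (κ → ℝ) × ℝ => Function.update p.1 k p.2) := by
    rw [measurable_pi_iff]; intro a
    by_cases h : a = k
    · subst h; simpa using measurable_snd
    · simp only [Function.update_of_ne h]; fun_prop
  refine ⟨hm, ?_⟩
  symm
  refine Measure.pi_eq fun s hs => ?_
  rw [Measure.map_apply hm (MeasurableSet.univ_pi hs)]
  have : (fun p : (κ → ℝ) × ℝ => Function.update p.1 k p.2) ⁻¹' (Set.univ.pi s)
      = (Set.univ.pi (Function.update s k Set.univ)) ×ˢ s k := by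
    ext p
    simp only [Set.mem_preimage, Set.mem_pi, Set.mem_univ, true_implies, Set.mem_prod]
    constructor
    · intro h
      refine ⟨fun a => ?_, by simpa using h k⟩
      by_cases ha : a = k
      · subst ha; simp
      · have := h a; simpa [ha] using this
    · rintro ⟨h, h2⟩ a
      by_cases ha : a = k
      · subst ha; simpa using h2
      · have := h a; simpa [ha] using this
  rw [this, Measure.prod_prod, Measure.pi_pi]
  rw [← Finset.mul_prod_erase _ _ (Finset.mem_univ k), ← Finset.mul_prod_erase _ (fun i => μ (s i)) (Finset.mem_univ k)]
  simp only [Function.update_self, measure_univ, one_mul]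
  rw [mul_comm]
  congr 1
  refine Finset.prod_congr rfl fun a ha => ?_
  rw [Function.update_of_ne (Finset.ne_of_mem_erase ha)]

lemma integrable_coord {κ : Type*} [Fintype κ] (k : κ) :
    Integrable (fun z : κ → ℝ => z k) (Measure.pi fun _ : κ => γ₁) :=
  (measurePreserving_eval (fun _ : κ => γ₁) k).integrable_comp_of_integrable integrable_id_g

lemma steinpi {κ : Type*} [Fintype κ] [DecidableEq κ] (k : κ) (G G' : (κ → ℝ) → ℝ) (C : ℝ)
    (hG : ∀ z t, HasDerivAt (fun t => G (Function.update z k t)) (G' (Function.update z k t)) t)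
    (hc : Continuous G) (hc' : Continuous G') (hb : ∀ x, |G x| ≤ C) (hb' : ∀ x, |G' x| ≤ C) :
    ∫ z, z k * G z ∂(Measure.pi fun _ : κ => γ₁) = ∫ z, G' z ∂(Measure.pi fun _ : κ => γ₁) := by
  have mp := update_mp γ₁ k
  have i2 : Integrable G' (Measure.pi fun _ : κ => γ₁) := Integrable.of_bound hc'.aestronglyMeasurable C
    (Filter.Eventually.of_forall hb')
  have i3 : Integrable (fun z => z k * G z) (Measure.pi fun _ : κ => γ₁) :=
    (integrable_coord k).mul_bdd (c := C) hc.aestronglyMeasurable (Filter.Eventually.of_forall hb)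
  have e1 : ∀ H : (κ → ℝ) → ℝ, Integrable H (Measure.pi fun _ : κ => γ₁) →
      ∫ z, H z ∂(Measure.pi fun _ : κ => γ₁) =
      ∫ z, (∫ t, H (Function.update z k t) ∂γ₁) ∂(Measure.pi fun _ : κ => γ₁) := by
    intro H hH
    have h2 := (mp.integrable_comp hH.aestronglyMeasurable).2 hH
    have h3 := integral_prod _ h2
    simp only [Function.comp] at h3
    rw [← h3]
    conv_lhs => rw [← mp.map_eq]
    rw [integral_map mp.aemeasurable (by rw [mp.map_eq]; exact hH.aestronglyMeasurable)]
  rw [e1 _ i2, e1 _ i3]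
  congr 1; ext z
  simp only [Function.update_self]
  exact stein1 _ _ C (hG z) (hc'.comp (by fun_prop)) (fun _ => hb _) (fun _ => hb' _)



noncomputable def Zp {κ J : Type*} [Fintype κ] (A B : J → κ → ℝ) (θ : ℝ) (z : κ → ℝ) : J → ℝ :=
  fun j => Real.cos θ * ∑ k, B j k * z k + Real.sin θ * ∑ k, A j k * z k

lemma Zp_cont {κ J : Type*} [Fintype κ] (A B : J → κ → ℝ) (θ : ℝ) : Continuous (Zp A B θ) := by
  unfold Zp; fun_prop

lemma Zp_deriv {κ J : Type*} [Fintype κ] [Fintype J] (A B : J → κ → ℝ) (θ : ℝ) (z : κ → ℝ) :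
    HasDerivAt (fun θ => Zp A B θ z)
      (fun j => ∑ k, (Real.cos θ * A j k - Real.sin θ * B j k) * z k) θ := by
  rw [hasDerivAt_pi]
  intro j
  have h := ((Real.hasDerivAt_cos θ).mul_const (∑ k, B j k * z k)).add
    ((Real.hasDerivAt_sin θ).mul_const (∑ k, A j k * z k))
  refine h.congr_deriv ?_
  rw [Finset.mul_sum, Finset.mul_sum, ← Finset.sum_add_distrib]
  exact Finset.sum_congr rfl fun k _ => by ring

lemma Zp_update {κ J : Type*} [Fintype κ] [DecidableEq κ] [Fintype J] (A B : J → κ → ℝ) (θ : ℝ)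
    (z : κ → ℝ) (k : κ) (t : ℝ) :
    HasDerivAt (fun t => Zp A B θ (Function.update z k t))
      (fun j => Real.cos θ * B j k + Real.sin θ * A j k) t := by
  rw [hasDerivAt_pi]
  intro j
  have h : ∀ A : J → κ → ℝ, HasDerivAt (fun t => ∑ l, A j l * Function.update z k t l) (A j k) t := by
    intro A
    have : ∀ l ∈ (Finset.univ : Finset κ), HasDerivAt (fun t => A j l * Function.update z k t l)
        (A j l * (Pi.single k (1:ℝ) : κ → ℝ) l) t := by
      intro l _
      exact ((hasDerivAt_pi.1 (hasDerivAt_update z k t)) l).const_mul _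
    have h2 := HasDerivAt.fun_sum this
    refine h2.congr_deriv ?_
    simp [Pi.single_apply]
  exact ((h B).const_mul _).add ((h A).const_mul _)

lemma chain_pi {J : Type*} [Fintype J] {F : (J → ℝ) → ℝ} {D : J → ℝ} {p : ℝ → J → ℝ} {p' : J → ℝ}
    {t : ℝ} (hF : HasFDerivAt F (∑ j, D j • (ContinuousLinearMap.proj j : (J → ℝ) →L[ℝ] ℝ)) (p t))
    (hp : HasDerivAt p p' t) : HasDerivAt (fun t => F (p t)) (∑ j, D j * p' j) t := by
  have := hF.comp_hasDerivAt t hp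
  refine this.congr_deriv ?_
  simp

lemma interp_deriv {κ J : Type*} [Fintype κ] [DecidableEq κ] [Fintype J]
    (A B : J → κ → ℝ) (F : (J → ℝ) → ℝ) (D : J → (J → ℝ) → ℝ) (D2 : J → J → (J → ℝ) → ℝ) (C : ℝ)
    (hF : ∀ x, HasFDerivAt F (∑ j, D j x • (ContinuousLinearMap.proj j : (J → ℝ) →L[ℝ] ℝ)) x)
    (hD : ∀ i x, HasFDerivAt (D i) (∑ j, D2 i j x • (ContinuousLinearMap.proj j : (J → ℝ) →L[ℝ] ℝ)) x)
    (hD2 : ∀ i j, Continuous (D2 i j))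
    (bF : ∀ x, |F x| ≤ C) (bD : ∀ i x, |D i x| ≤ C) (bD2 : ∀ i j x, |D2 i j x| ≤ C)
    (hAB : ∀ i j, ∑ k, A i k * B j k = 0) (θ : ℝ) :
    HasDerivAt (fun θ => ∫ z, F (Zp A B θ z) ∂(Measure.pi fun _ : κ => γ₁))
      (Real.sin θ * Real.cos θ * ∫ z, ∑ i, ∑ j, (∑ k, A i k * A j k - ∑ k, B i k * B j k) * D2 i j (Zp A B θ z)
        ∂(Measure.pi fun _ : κ => γ₁)) θ := by
  have hFc : Continuous F := continuous_iff_continuousAt.2 fun x => (hF x).continuousAt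
  have hDc : ∀ i, Continuous (D i) := fun i => continuous_iff_continuousAt.2 fun x => (hD i x).continuousAt
  have hDz : ∀ i θ, Continuous fun z => D i (Zp A B θ z) := fun i θ => (hDc i).comp (Zp_cont A B θ)
  have hD2z : ∀ i j, Continuous fun z => D2 i j (Zp A B θ z) := fun i j => (hD2 i j).comp (Zp_cont A B θ)
  have key := hasDerivAt_integral_of_dominated_loc_of_deriv_le
    (μ := Measure.pi fun _ : κ => γ₁) (F := fun θ z => F (Zp A B θ z)) (x₀ := θ) (s := Set.univ)
    (F' := fun θ z => ∑ j, D j (Zp A B θ z) * ∑ k, (Real.cos θ * A j k - Real.sin θ * B j k) * z k)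
    (bound := fun z => ∑ j, C * ∑ k, (|A j k| + |B j k|) * |z k|)
    Filter.univ_mem
    (Filter.Eventually.of_forall fun θ => (hFc.comp (Zp_cont A B θ)).aestronglyMeasurable)
    (Integrable.of_bound (hFc.comp (Zp_cont A B θ)).aestronglyMeasurable C
      (Filter.Eventually.of_forall fun _ => bF _))
    (by
      apply Continuous.aestronglyMeasurable
      exact continuous_finsetSum _ fun j _ => (hDz j θ).mul (by fun_prop))
    (by
      refine Filter.Eventually.of_forall fun z t _ => ?_
      refine (norm_sum_le _ _).trans (Finset.sum_le_sum fun j _ => ?_)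
      rw [norm_mul]
      refine mul_le_mul (bD _ _) ?_ (norm_nonneg _) ((abs_nonneg _).trans (bD j 0))
      refine (norm_sum_le _ _).trans (Finset.sum_le_sum fun k _ => ?_)
      rw [norm_mul, Real.norm_eq_abs, Real.norm_eq_abs]
      refine mul_le_mul_of_nonneg_right ?_ (abs_nonneg _)
      refine (abs_sub _ _).trans ?_
      rw [abs_mul, abs_mul]
      have h1 := Real.abs_cos_le_one t
      have h2 := Real.abs_sin_le_one t
      nlinarith [abs_nonneg (A j k), abs_nonneg (B j k)])
    (by
      refine integrable_finsetSum _ fun j _ => Integrable.const_mul (integrable_finsetSum _ fun k _ => ?_) _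
      exact (integrable_coord k).abs.const_mul _)
    (by
      refine Filter.Eventually.of_forall fun z t _ => ?_
      exact chain_pi (hF _) (Zp_deriv A B t z))
  refine key.2.congr_deriv ?_
  have iz : ∀ i k, Integrable (fun z => z k * D i (Zp A B θ z)) (Measure.pi fun _ : κ => γ₁) := fun i k =>
    (integrable_coord k).mul_bdd (c := C) (hDz i θ).aestronglyMeasurable (Filter.Eventually.of_forall fun _ => bD _ _)
  have i2 : ∀ i j, Integrable (fun z => D2 i j (Zp A B θ z)) (Measure.pi fun _ : κ => γ₁) := fun i j =>
    Integrable.of_bound (hD2z i j).aestronglyMeasurable C (Filter.Eventually.of_forall fun _ => bD2 _ _ _)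
  have st : ∀ i k, ∫ z, z k * D i (Zp A B θ z) ∂(Measure.pi fun _ : κ => γ₁)
      = ∑ j, (Real.cos θ * B j k + Real.sin θ * A j k) * ∫ z, D2 i j (Zp A B θ z) ∂(Measure.pi fun _ : κ => γ₁) := by
    intro i k
    rw [steinpi k (fun z => D i (Zp A B θ z))
      (fun z => ∑ j, D2 i j (Zp A B θ z) * (Real.cos θ * B j k + Real.sin θ * A j k))
      (max C (∑ j, C * |Real.cos θ * B j k + Real.sin θ * A j k|))]
    · rw [integral_finsetSum _ fun j _ => (i2 i j).mul_const _]
      exact Finset.sum_congr rfl fun j _ => by rw [integral_mul_const, mul_comm]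
    · intro z t
      exact chain_pi (hD i _) (Zp_update A B θ z k t)
    · exact hDz i θ
    · exact continuous_finsetSum _ fun j _ => (hD2z i j).mul continuous_const
    · intro x; exact (bD _ _).trans (le_max_left _ _)
    · intro x
      refine le_trans ?_ (le_max_right _ _)
      refine (Finset.abs_sum_le_sum_abs _ _).trans (Finset.sum_le_sum fun j _ => ?_)
      rw [abs_mul]
      exact mul_le_mul_of_nonneg_right (bD2 _ _ _) (abs_nonneg _)
  have e1 : ∫ z, ∑ j, D j (Zp A B θ z) * ∑ k, (Real.cos θ * A j k - Real.sin θ * B j k) * z k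
      ∂(Measure.pi fun _ : κ => γ₁) =
      ∑ i, ∑ k, (Real.cos θ * A i k - Real.sin θ * B i k) *
        ∫ z, z k * D i (Zp A B θ z) ∂(Measure.pi fun _ : κ => γ₁) := by
    have : ∀ z : κ → ℝ, ∑ j, D j (Zp A B θ z) * ∑ k, (Real.cos θ * A j k - Real.sin θ * B j k) * z k
        = ∑ i, ∑ k, (Real.cos θ * A i k - Real.sin θ * B i k) * (z k * D i (Zp A B θ z)) := by
      intro z
      refine Finset.sum_congr rfl fun j _ => ?_
      rw [Finset.mul_sum]
      exact Finset.sum_congr rfl fun k _ => by ring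
    simp_rw [this]
    rw [integral_finsetSum _ fun i _ => integrable_finsetSum _ fun k _ => (iz i k).const_mul _]
    refine Finset.sum_congr rfl fun i _ => ?_
    rw [integral_finsetSum _ fun k _ => (iz i k).const_mul _]
    exact Finset.sum_congr rfl fun k _ => integral_const_mul _ _
  rw [e1]
  rw [integral_finsetSum _ fun i _ => integrable_finsetSum _ fun k _ => (i2 i k).const_mul _, Finset.mul_sum]
  refine Finset.sum_congr rfl fun i _ => ?_
  rw [integral_finsetSum _ fun k _ => (i2 i k).const_mul _, Finset.mul_sum]
  simp_rw [st, Finset.mul_sum]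
  rw [Finset.sum_comm]
  refine Finset.sum_congr rfl fun j _ => ?_
  rw [integral_const_mul]
  simp_rw [← mul_assoc]
  rw [← Finset.sum_mul]
  congr 1
  have ab := hAB i j
  have ba := hAB j i
  calc _ = ∑ k, (Real.sin θ * Real.cos θ * (A i k * A j k) - Real.sin θ * Real.cos θ * (B i k * B j k)
          + Real.cos θ ^ 2 * (A i k * B j k) - Real.sin θ ^ 2 * (A j k * B i k)) := 
        Finset.sum_congr rfl fun k _ => by ring
    _ = _ := by
      rw [Finset.sum_sub_distrib, Finset.sum_add_distrib, Finset.sum_sub_distrib]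
      simp_rw [← Finset.mul_sum]
      rw [ab, ba]; ring

lemma interp {κ J : Type*} [Fintype κ] [Fintype J]
    (A B : J → κ → ℝ) (F : (J → ℝ) → ℝ) (D : J → (J → ℝ) → ℝ) (D2 : J → J → (J → ℝ) → ℝ) (C : ℝ)
    (hF : ∀ x, HasFDerivAt F (∑ j, D j x • (ContinuousLinearMap.proj j : (J → ℝ) →L[ℝ] ℝ)) x)
    (hD : ∀ i x, HasFDerivAt (D i) (∑ j, D2 i j x • (ContinuousLinearMap.proj j : (J → ℝ) →L[ℝ] ℝ)) x)
    (hD2 : ∀ i j, Continuous (D2 i j))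
    (bF : ∀ x, |F x| ≤ C) (bD : ∀ i x, |D i x| ≤ C) (bD2 : ∀ i j x, |D2 i j x| ≤ C)
    (hAB : ∀ i j, ∑ k, A i k * B j k = 0)
    (hneg : ∀ x, ∑ i, ∑ j, (∑ k, A i k * A j k - ∑ k, B i k * B j k) * D2 i j x ≤ 0) :
    ∫ z, F (fun j => ∑ k, A j k * z k) ∂(Measure.pi fun _ : κ => γ₁) ≤
    ∫ z, F (fun j => ∑ k, B j k * z k) ∂(Measure.pi fun _ : κ => γ₁) := by
  classical
  have hd := interp_deriv A B F D D2 C hF hD hD2 bF bD bD2 hAB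
  have anti : AntitoneOn (fun θ => ∫ z, F (Zp A B θ z) ∂(Measure.pi fun _ : κ => γ₁))
      (Set.Icc 0 (Real.pi / 2)) := by
    apply antitoneOn_of_deriv_nonpos (convex_Icc _ _)
    · exact fun x _ => (hd x).continuousAt.continuousWithinAt
    · exact fun x _ => (hd x).differentiableAt.differentiableWithinAt
    · intro x hx
      rw [interior_Icc] at hx
      rw [(hd x).deriv]
      refine mul_nonpos_of_nonneg_of_nonpos (mul_nonneg ?_ ?_) ?_
      · exact Real.sin_nonneg_of_nonneg_of_le_pi hx.1.le (by linarith [hx.2, Real.pi_pos])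
      · exact Real.cos_nonneg_of_neg_pi_div_two_le_of_le (by linarith [hx.1, Real.pi_pos]) hx.2.le
      · exact integral_nonpos fun z => hneg _
  have := anti (Set.left_mem_Icc.2 (by positivity)) (Set.right_mem_Icc.2 (by positivity)) (by positivity)
  have e0 : ∀ z : κ → ℝ, Zp A B 0 z = fun j => ∑ k, B j k * z k := by
    intro z; funext j; simp [Zp]
  have e1 : ∀ z : κ → ℝ, Zp A B (Real.pi / 2) z = fun j => ∑ k, A j k * z k := by
    intro z; funext j; simp [Zp]
  simpa only [e0, e1] using this



def HG {J : Type*} [Fintype J] (f : (J → ℝ) → ℝ) (c : J → ℝ) (x : J → ℝ) : Prop :=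
  HasFDerivAt f (∑ j, c j • (ContinuousLinearMap.proj j : (J → ℝ) →L[ℝ] ℝ)) x

section HG
variable {J : Type*} [Fintype J] {f g : (J → ℝ) → ℝ} {c d : J → ℝ} {x : J → ℝ}

lemma HG.congr (h : HG f c x) (e : c = d) : HG f d x := e ▸ h

lemma HG.add (hf : HG f c x) (hg : HG g d x) : HG (fun x => f x + g x) (fun j => c j + d j) x := by
  unfold HG at *
  refine (HasFDerivAt.add hf hg).congr_fderiv ?_
  simp [add_smul, Finset.sum_add_distrib]

lemma HG.mul (hf : HG f c x) (hg : HG g d x) :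
    HG (fun x => f x * g x) (fun j => c j * g x + f x * d j) x := by
  unfold HG at *
  refine (HasFDerivAt.mul hf hg).congr_fderiv ?_
  ext v
  simp [Finset.mul_sum, ← Finset.sum_add_distrib]
  exact Finset.sum_congr rfl fun _ _ => by ring

lemma HG.comp {φ : ℝ → ℝ} {φ' : ℝ} (hφ : HasDerivAt φ φ' (f x)) (hf : HG f c x) :
    HG (fun x => φ (f x)) (fun j => φ' * c j) x := by
  unfold HG at *
  refine (hφ.comp_hasFDerivAt x hf).congr_fderiv ?_
  ext v
  simp [Finset.mul_sum]
  exact Finset.sum_congr rfl fun _ _ => by ring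

lemma HG.sum {ι : Type*} (s : Finset ι) {f : ι → (J → ℝ) → ℝ} {c : ι → J → ℝ}
    (h : ∀ i ∈ s, HG (f i) (c i) x) : HG (fun x => ∑ i ∈ s, f i x) (fun j => ∑ i ∈ s, c i j) x := by
  unfold HG at *
  refine (HasFDerivAt.fun_sum h).congr_fderiv ?_
  simp_rw [Finset.sum_smul]
  exact Finset.sum_comm

lemma HG.proj [DecidableEq J] (j : J) : HG (fun x => x j) (Pi.single j 1) x := by
  unfold HG
  refine (hasFDerivAt_apply j x).congr_fderiv ?_
  ext v
  simp [Pi.single_apply]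

end HG

section func
set_option linter.unusedSectionVars false
set_option linter.unusedSimpArgs false
variable {I : Type*} [Fintype I] [DecidableEq I] {m : ℕ}

noncomputable def rr (u : Option (Fin m) → ℝ) : ℝ := Real.sqrt (1 + ∑ k, u (some k) ^ 2)

noncomputable def Lg (a : Option (Fin m)) (u : Option (Fin m) → ℝ) : ℝ :=
  match a with
  | none => 1
  | some k => u (some k) * (rr u)⁻¹

noncomputable def Lh (a a' : Option (Fin m)) (u : Option (Fin m) → ℝ) : ℝ :=
  match a, a' with
  | some k, some k' => (if k = k' then 1 else 0) * (rr u)⁻¹ - u (some k) * u (some k') * (rr u)⁻¹ ^ 3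
  | _, _ => 0

noncomputable def yy (p l : ℝ) (i : I) (x : I × Option (Fin m) → ℝ) : ℝ :=
  Real.exp (-p * (rr (fun a => x (i, a)) + x (i, none) + l))

noncomputable def qq (p l : ℝ) (x : I × Option (Fin m) → ℝ) : ℝ := (1 + ∑ i, yy p l i x)⁻¹

noncomputable def FF (p l : ℝ) (x : I × Option (Fin m) → ℝ) : ℝ := 1 - qq p l x

noncomputable def DD (p l : ℝ) (j : I × Option (Fin m)) (x : I × Option (Fin m) → ℝ) : ℝ :=
  -p * (yy p l j.1 x * (qq p l x * qq p l x) * Lg j.2 (fun a => x (j.1, a)))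

noncomputable def DD2 (p l : ℝ) (j j' : I × Option (Fin m)) (x : I × Option (Fin m) → ℝ) : ℝ :=
  (if j'.1 = j.1 then
    p ^ 2 * yy p l j.1 x * (qq p l x) ^ 2 * Lg j.2 (fun a => x (j.1, a)) * Lg j'.2 (fun a => x (j.1, a))
    - p * yy p l j.1 x * (qq p l x) ^ 2 * Lh j.2 j'.2 (fun a => x (j.1, a)) else 0)
  - 2 * p ^ 2 * yy p l j.1 x * yy p l j'.1 x * (qq p l x) ^ 3 * Lg j.2 (fun a => x (j.1, a)) *
    Lg j'.2 (fun a => x (j'.1, a))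

lemma rr_sq (u : Option (Fin m) → ℝ) : rr u ^ 2 = 1 + ∑ k, u (some k) ^ 2 :=
  Real.sq_sqrt (by positivity)

lemma one_le_rr (u : Option (Fin m) → ℝ) : 1 ≤ rr u := by
  rw [rr, Real.one_le_sqrt]
  have : 0 ≤ ∑ k, u (some k) ^ 2 := by positivity
  linarith

lemma rr_pos (u : Option (Fin m) → ℝ) : 0 < rr u := zero_lt_one.trans_le (one_le_rr u)

lemma yy_pos (p l : ℝ) (i : I) (x : I × Option (Fin m) → ℝ) : 0 < yy p l i x := Real.exp_pos _

lemma sumyy (p l : ℝ) (x : I × Option (Fin m) → ℝ) : 0 ≤ ∑ i, yy p l i x :=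
  Finset.sum_nonneg fun i _ => (yy_pos p l i x).le

lemma qq_pos (p l : ℝ) (x : I × Option (Fin m) → ℝ) : 0 < qq p l x := by
  have := sumyy p l x
  unfold qq; positivity

lemma qq_le (p l : ℝ) (x : I × Option (Fin m) → ℝ) : qq p l x ≤ 1 := by
  have := sumyy p l x
  unfold qq
  exact inv_le_one_of_one_le₀ (by linarith)

lemma yq_le (p l : ℝ) (i : I) (x : I × Option (Fin m) → ℝ) : yy p l i x * qq p l x ≤ 1 := by
  have h1 := sumyy p l x
  have h2 : yy p l i x ≤ ∑ i, yy p l i x :=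
    Finset.single_le_sum (fun i _ => (yy_pos p l i x).le) (Finset.mem_univ i)
  unfold qq
  rw [← div_eq_mul_inv, div_le_one (by positivity)]
  linarith

lemma sum_Lg_sq (u : Option (Fin m) → ℝ) : ∑ k, Lg (some k) u ^ 2 ≤ 1 := by
  have h := rr_sq u
  have hp := rr_pos u
  simp only [Lg, mul_pow]
  rw [← Finset.sum_mul, inv_pow, ← div_eq_mul_inv, div_le_one (by positivity)]
  linarith

lemma abs_Lg (a : Option (Fin m)) (u : Option (Fin m) → ℝ) : |Lg a u| ≤ 1 := by
  cases a with
  | none => simp [Lg]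
  | some k =>
    rw [abs_le_one_iff_mul_self_le_one, ← sq]
    exact (Finset.single_le_sum (f := fun k => Lg (some k) u ^ 2) (fun i _ => sq_nonneg _)
      (Finset.mem_univ k)).trans (sum_Lg_sq u)

lemma abs_Lh (a a' : Option (Fin m)) (u : Option (Fin m) → ℝ) : |Lh a a' u| ≤ 2 := by
  have hi : 0 < (rr u)⁻¹ := inv_pos.2 (rr_pos u)
  have hi1 : (rr u)⁻¹ ≤ 1 := inv_le_one_of_one_le₀ (one_le_rr u)
  cases a with
  | none => simp [Lh]
  | some k =>
    cases a' with
    | none => simp [Lh]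
    | some k' =>
      have e : Lh (some k) (some k') u = (if k = k' then 1 else 0) * (rr u)⁻¹
        - Lg (some k) u * Lg (some k') u * (rr u)⁻¹ := by simp only [Lh, Lg]; ring
      rw [e]
      have h1 := abs_Lg (some k) u
      have h2 := abs_Lg (some k') u
      refine (abs_sub _ _).trans ?_
      rw [abs_mul, abs_mul, abs_mul, abs_of_pos hi]
      have h3 : |(if k = k' then (1:ℝ) else 0)| ≤ 1 := by split_ifs <;> simp
      have h4 : |Lg (some k) u| * |Lg (some k') u| ≤ 1 := mul_le_one₀ h1 (abs_nonneg _) h2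
      nlinarith [abs_nonneg (Lg (some k) u)]

lemma HG_rr (i : I) (x : I × Option (Fin m) → ℝ) :
    HG (fun x => rr (fun a => x (i, a))) (fun j => if j.1 = i then
      (match j.2 with | none => 0 | some k => Lg (some k) (fun a => x (i, a))) else 0) x := by
  have hp := rr_pos (fun a => x (i, a))
  have h1 : HG (fun x : I × Option (Fin m) → ℝ => ∑ k : Fin m, x (i, some k) * x (i, some k)) _ x :=
    HG.sum Finset.univ fun k _ => (HG.proj (i, some k)).mul (HG.proj (i, some k))
  have h2 : HasDerivAt (fun s : ℝ => Real.sqrt (1 + s)) (1 / (2 * rr (fun a => x (i, a))))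
      (∑ k : Fin m, x (i, some k) * x (i, some k)) := by
    have e : rr (fun a => x (i, a)) = Real.sqrt (1 + ∑ k : Fin m, x (i, some k) * x (i, some k)) := by
      simp [rr, sq]
    rw [e]
    refine HasDerivAt.sqrt ((hasDerivAt_id' _).const_add 1) ?_
    have : 0 ≤ ∑ k : Fin m, x (i, some k) * x (i, some k) :=
      Finset.sum_nonneg fun _ _ => mul_self_nonneg _
    linarith
  have h3 := HG.comp (f := fun x : I × Option (Fin m) → ℝ => ∑ k : Fin m, x (i, some k) * x (i, some k)) h2 h1
  have e : (fun x : I × Option (Fin m) → ℝ => rr (fun a => x (i, a))) =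
    fun x => Real.sqrt (1 + ∑ k : Fin m, x (i, some k) * x (i, some k)) := by
      funext x; simp [rr, sq]
  rw [e]
  refine h3.congr ?_
  funext ⟨i', a⟩
  simp only [Pi.single_apply, Prod.mk.injEq]
  by_cases hi : i' = i
  · subst hi
    cases a with
    | none => simp
    | some k =>
      simp [Finset.sum_add_distrib, Lg]
      field_simp
      ring
  · simp [hi]

lemma HG_L (l : ℝ) (i : I) (x : I × Option (Fin m) → ℝ) :
    HG (fun x => rr (fun a => x (i, a)) + x (i, none) + l) (fun j => if j.1 = i then
      Lg j.2 (fun a => x (i, a)) else 0) x := by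
  have h := (HG_rr i x).add (HG.proj (x := x) (i, none))
  have h2 := HG.comp ((hasDerivAt_id' _).add_const l) h
  refine h2.congr ?_
  funext ⟨i', a⟩
  by_cases hi : i' = i
  · subst hi
    cases a <;> simp [Lg, Pi.single_apply]
  · simp [hi, Pi.single_apply]

lemma HG_yy (p l : ℝ) (i : I) (x : I × Option (Fin m) → ℝ) :
    HG (yy p l i) (fun j => if j.1 = i then
      -p * yy p l i x * Lg j.2 (fun a => x (i, a)) else 0) x := by
  have h := HG.comp (φ := fun s => Real.exp (-p * s))
    (((hasDerivAt_id' _).const_mul (-p)).exp) (HG_L l i x)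
  refine h.congr ?_
  funext ⟨i', a⟩
  by_cases hi : i' = i
  · simp only [hi, yy, if_true]; ring
  · simp [hi]

lemma HG_qq (p l : ℝ) (x : I × Option (Fin m) → ℝ) :
    HG (qq p l) (fun j => p * yy p l j.1 x * Lg j.2 (fun a => x (j.1, a)) * qq p l x ^ 2) x := by
  have hs := sumyy p l x
  have h1 : HG (fun x => ∑ i, yy p l i x) _ x := HG.sum Finset.univ fun i _ => HG_yy p l i x
  have h := HG.comp (φ := fun s => (1 + s)⁻¹)
    (((hasDerivAt_id' _).const_add 1).inv (by positivity)) h1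
  refine h.congr ?_
  funext ⟨i', a⟩
  simp [qq]
  field_simp

lemma HG_FF (p l : ℝ) (x : I × Option (Fin m) → ℝ) :
    HG (FF p l) (fun j => DD p l j x) x := by
  have h := HG.comp (φ := fun s => 1 - s) ((hasDerivAt_id' _).const_sub 1) (HG_qq p l x)
  refine h.congr ?_
  funext ⟨i', a⟩
  simp [DD]; ring

lemma HG_Lg (i : I) (a : Option (Fin m)) (x : I × Option (Fin m) → ℝ) :
    HG (fun x => Lg a (fun a => x (i, a))) (fun j => if j.1 = i then
      Lh a j.2 (fun a => x (i, a)) else 0) x := by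
  have hp := rr_pos (fun a => x (i, a))
  cases a with
  | none =>
    have : HG (fun _ : I × Option (Fin m) → ℝ => (1 : ℝ)) (fun _ => 0) x := by
      unfold HG; simpa using! hasFDerivAt_const (1 : ℝ) x
    simpa [Lg, Lh] using! this
  | some k =>
    have h1 := HG.comp (f := fun x : I × Option (Fin m) → ℝ => rr (fun a => x (i, a))) (φ := fun s => s⁻¹) ((hasDerivAt_id' _).inv hp.ne') (HG_rr i x)
    have h2 := (HG.proj (x := x) (i, some k)).mul h1
    refine h2.congr ?_
    funext ⟨i', a⟩
    by_cases hi : i' = i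
    · subst hi
      cases a with
      | none => simp [Lh, Pi.single_apply]
      | some k' =>
        simp [Lh, Lg, Pi.single_apply, eq_comm]
        field_simp
        try ring
    · simp [hi, Pi.single_apply]

lemma HG_DD (p l : ℝ) (j : I × Option (Fin m)) (x : I × Option (Fin m) → ℝ) :
    HG (DD p l j) (fun j' => DD2 p l j j' x) x := by
  have hq := HG_qq p l x
  have h := HG.comp (φ := fun s => -p * s) ((hasDerivAt_id' _).const_mul (-p))
    (((HG_yy p l j.1 x).mul (hq.mul hq)).mul (HG_Lg j.1 j.2 x))
  refine h.congr ?_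
  funext ⟨i', a⟩
  obtain ⟨i, b⟩ := j
  by_cases hi : i' = i
  · subst hi
    simp [DD2]; ring
  · simp [hi, DD2]; ring

lemma DD2_cont (p l : ℝ) (j j' : I × Option (Fin m)) : Continuous (DD2 p l j j') := by
  have hy : ∀ i : I, Continuous (yy (m := m) p l i) := fun i => continuous_iff_continuousAt.2 fun x =>
    (HG_yy p l i x).continuousAt
  have hq : Continuous (qq (I := I) (m := m) p l) := continuous_iff_continuousAt.2 fun x =>
    (HG_qq p l x).continuousAt
  have hL : ∀ (i : I) a, Continuous (fun x : I × Option (Fin m) → ℝ => Lg a (fun a => x (i, a))) :=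
    fun i a => continuous_iff_continuousAt.2 fun x => (HG_Lg i a x).continuousAt
  have hr : ∀ (i : I), Continuous (fun x : I × Option (Fin m) → ℝ => (rr (fun a => x (i, a)))⁻¹) :=
    fun i => Continuous.inv₀ (continuous_iff_continuousAt.2 fun x => (HG_rr i x).continuousAt)
      fun x => (rr_pos _).ne'
  have hLh : ∀ (i : I) a a', Continuous (fun x : I × Option (Fin m) → ℝ => Lh a a' (fun a => x (i, a))) := by
    intro i a a'
    have := hr i
    cases a <;> cases a' <;> simp only [Lh] <;> fun_prop
  have h1 := hy j.1
  have h2 := hy j'.1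
  have h3 := hL j.1 j.2
  have h4 := hL j'.1 j'.2
  have h5 := hLh j.1 j.2 j'.2
  have h6 := hL j.1 j'.2
  unfold DD2
  split_ifs <;> fun_prop

end func



lemma FF_bd {I : Type*} [Fintype I] {m : ℕ} (p l : ℝ) (x : I × Option (Fin m) → ℝ) :
    0 ≤ FF p l x ∧ FF p l x ≤ 1 := by
  classical
  have h1 := qq_pos p l x
  have h2 := qq_le p l x
  unfold FF
  constructor <;> linarith

lemma FF_cont {I : Type*} [Fintype I] {m : ℕ} (p l : ℝ) : Continuous (FF (I := I) (m := m) p l) := by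
  classical
  exact continuous_iff_continuousAt.2 fun x => (HG_FF p l x).continuousAt

lemma abstract_gordon {I κ : Type*} [Fintype I] [DecidableEq I] [Fintype κ] {m : ℕ} (p l : ℝ) (hp : 0 < p)
    (A B : I × Option (Fin m) → κ → ℝ) (ρ : I → I → ℝ) (hρ : ∀ i i', ρ i i' ≤ 1) (hρ1 : ∀ i, ρ i i = 1)
    (hAB : ∀ i j, ∑ k, A i k * B j k = 0)
    (hcov : ∀ i a i' a', ∑ k, A (i, a) k * A (i', a') k - ∑ k, B (i, a) k * B (i', a') k
      = if a = a' then (if a = none then 1 - ρ i i' else ρ i i' - 1) else 0) :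
    ∫ z, FF p l (fun j => ∑ k, A j k * z k) ∂(Measure.pi fun _ : κ => γ₁) ≤
    ∫ z, FF p l (fun j => ∑ k, B j k * z k) ∂(Measure.pi fun _ : κ => γ₁) := by
  refine interp A B (FF p l) (DD p l) (DD2 p l) (1 + p + 3 * p ^ 2 + 2 * p) (HG_FF p l) (HG_DD p l)
    (DD2_cont p l) ?_ ?_ ?_ hAB ?_
  · intro x
    obtain ⟨h1, h2⟩ := FF_bd p l x
    rw [abs_of_nonneg h1]; nlinarith
  · intro j x
    have hy := yy_pos p l j.1 x
    have hq := qq_pos p l x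
    have hq1 := qq_le p l x
    have hyq := yq_le p l j.1 x
    have hL := abs_Lg j.2 (fun a => x (j.1, a))
    rw [DD, abs_mul, abs_mul, abs_neg, abs_of_pos hp, abs_of_pos (by positivity)]
    have h3 : yy p l j.1 x * (qq p l x * qq p l x) ≤ 1 := by
      rw [← mul_assoc]; exact mul_le_one₀ hyq hq.le hq1
    have h4 : yy p l j.1 x * (qq p l x * qq p l x) * |Lg j.2 (fun a => x (j.1, a))| ≤ 1 :=
      mul_le_one₀ h3 (abs_nonneg _) hL
    nlinarith
  · intro j j' x
    have hy := yy_pos p l j.1 x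
    have hy' := yy_pos p l j'.1 x
    have hq := qq_pos p l x
    have hq1 := qq_le p l x
    have hyq := yq_le p l j.1 x
    have hyq' := yq_le p l j'.1 x
    have hL := abs_Lg j.2 (fun a => x (j.1, a))
    have hL' := abs_Lg j'.2 (fun a => x (j'.1, a))
    have hL2 := abs_Lg j'.2 (fun a => x (j.1, a))
    have hLh := abs_Lh j.2 j'.2 (fun a => x (j.1, a))
    have a1 : yy p l j.1 x * qq p l x ^ 2 ≤ 1 := by
      rw [sq, ← mul_assoc]; exact mul_le_one₀ hyq hq.le hq1
    have a2 : yy p l j.1 x * yy p l j'.1 x * qq p l x ^ 3 ≤ 1 := by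
      calc _ = (yy p l j.1 x * qq p l x) * (yy p l j'.1 x * qq p l x) * qq p l x := by ring
        _ ≤ 1 := mul_le_one₀ (mul_le_one₀ hyq (by positivity) hyq') hq.le hq1
    have b1 : |p ^ 2 * yy p l j.1 x * (qq p l x) ^ 2 * Lg j.2 (fun a => x (j.1, a)) * Lg j'.2 (fun a => x (j.1, a))| ≤ p ^ 2 := by
      rw [abs_mul, abs_mul, abs_of_pos (by positivity)]
      calc _ = p ^ 2 * (yy p l j.1 x * (qq p l x) ^ 2 * (|Lg j.2 (fun a => x (j.1, a))| * |Lg j'.2 (fun a => x (j.1, a))|)) := by ring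
        _ ≤ p ^ 2 * 1 := by
          refine mul_le_mul_of_nonneg_left ?_ (by positivity)
          exact mul_le_one₀ a1 (by positivity) (mul_le_one₀ hL (by positivity) hL2)
        _ = _ := by ring
    have b2 : |p * yy p l j.1 x * (qq p l x) ^ 2 * Lh j.2 j'.2 (fun a => x (j.1, a))| ≤ 2 * p := by
      rw [abs_mul, abs_of_pos (by positivity)]
      calc _ = p * ((yy p l j.1 x * (qq p l x) ^ 2) * |Lh j.2 j'.2 (fun a => x (j.1, a))|) := by ring
        _ ≤ p * (1 * 2) := by
          refine mul_le_mul_of_nonneg_left ?_ (by positivity)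
          exact mul_le_mul a1 hLh (by positivity) (by norm_num)
        _ = _ := by ring
    have b3 : |2 * p ^ 2 * yy p l j.1 x * yy p l j'.1 x * (qq p l x) ^ 3 * Lg j.2 (fun a => x (j.1, a)) *
    Lg j'.2 (fun a => x (j'.1, a))| ≤ 2 * p ^ 2 := by
      rw [abs_mul, abs_mul, abs_of_pos (by positivity)]
      calc _ = 2 * p ^ 2 * (yy p l j.1 x * yy p l j'.1 x * (qq p l x) ^ 3 * (|Lg j.2 (fun a => x (j.1, a))| * |Lg j'.2 (fun a => x (j'.1, a))|)) := by ring
        _ ≤ 2 * p ^ 2 * 1 := by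
          refine mul_le_mul_of_nonneg_left ?_ (by positivity)
          exact mul_le_one₀ a2 (by positivity) (mul_le_one₀ hL (by positivity) hL')
        _ = _ := by ring
    unfold DD2
    refine (abs_sub _ _).trans ?_
    split_ifs
    · have := (abs_sub (p ^ 2 * yy p l j.1 x * (qq p l x) ^ 2 * Lg j.2 (fun a => x (j.1, a)) * Lg j'.2 (fun a => x (j.1, a))) (p * yy p l j.1 x * (qq p l x) ^ 2 * Lh j.2 j'.2 (fun a => x (j.1, a))))
      linarith
    · rw [abs_zero]; nlinarith
  · intro x
    have e : ∑ i, ∑ j, (∑ k, A i k * A j k - ∑ k, B i k * B j k) * DD2 p l i j x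
        = ∑ i, ∑ i', (1 - ρ i i') * (DD2 p l (i, none) (i', none) x
          - ∑ k : Fin m, DD2 p l (i, some k) (i', some k) x) := by
      rw [Fintype.sum_prod_type]
      refine Finset.sum_congr rfl fun i _ => ?_
      simp_rw [Fintype.sum_prod_type]
      rw [Finset.sum_comm]
      refine Finset.sum_congr rfl fun i' _ => ?_
      simp_rw [hcov]
      simp only [Fintype.sum_option, ite_mul, zero_mul, Finset.sum_ite_eq, Finset.mem_univ, if_true]
      simp [← Finset.mul_sum]
      ring
    rw [e]
    refine Finset.sum_nonpos fun i _ => Finset.sum_nonpos fun i' _ => ?_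
    by_cases hi : i' = i
    · subst hi; rw [hρ1]; simp
    · refine mul_nonpos_of_nonneg_of_nonpos (by linarith [hρ i i']) ?_
      simp only [DD2, hi, if_false]
      have h0 : ∑ k : Fin m, Lg (some k) (fun a => x (i, a)) * Lg (some k) (fun a => x (i', a)) ≤ 1 := by
        have h1 := sum_Lg_sq (fun a => x (i, a))
        have h2 := sum_Lg_sq (fun a => x (i', a))
        have : ∑ k : Fin m, Lg (some k) (fun a => x (i, a)) * Lg (some k) (fun a => x (i', a)) ≤
          ∑ k : Fin m, (Lg (some k) (fun a => x (i, a)) ^ 2 + Lg (some k) (fun a => x (i', a)) ^ 2) / 2 :=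
          Finset.sum_le_sum fun k _ => by
            nlinarith [sq_nonneg (Lg (some k) (fun a => x (i, a)) - Lg (some k) (fun a => x (i', a)))]
        rw [← Finset.sum_div, Finset.sum_add_distrib] at this
        linarith
      have hy := yy_pos p l i x
      have hy' := yy_pos p l i' x
      have hq := qq_pos p l x
      have hc : 0 < 2 * p ^ 2 * yy p l i x * yy p l i' x * qq p l x ^ 3 := by positivity
      simp only [zero_sub, Finset.sum_neg_distrib, mul_assoc (2 * p ^ 2 * yy p l i x * yy p l i' x * qq p l x ^ 3)]
      rw [← Finset.mul_sum]
      simp only [Lg] at h0 ⊢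
      nlinarith

abbrev KK (m n : ℕ) := ((Fin m × Fin n) ⊕ Unit) ⊕ (Fin m ⊕ Fin n)

def TT {m n : ℕ} (ω : ((Fin m → Fin n → ℝ) × ℝ) × ((Fin m → ℝ) × (Fin n → ℝ))) : KK m n → ℝ :=
  Sum.elim (Sum.elim (fun kl => ω.1.1 kl.1 kl.2) (fun _ => ω.1.2)) (Sum.elim ω.2.1 ω.2.2)

noncomputable abbrev μX (m n : ℕ) : Measure ((Fin m → Fin n → ℝ) × ℝ) := (matrixGaussian m n).prod γ₁
noncomputable abbrev μY (m n : ℕ) : Measure ((Fin m → ℝ) × (Fin n → ℝ)) :=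
  (Measure.pi fun _ => γ₁).prod (Measure.pi fun _ => γ₁)

instance (m n : ℕ) : IsProbabilityMeasure (matrixGaussian m n) := by
  unfold matrixGaussian; infer_instance

lemma TT_mp (m n : ℕ) : MeasurePreserving (TT (m := m) (n := n)) ((μX m n).prod (μY m n))
    (Measure.pi fun _ : KK m n => γ₁) := by
  have hm : Measurable (TT (m := m) (n := n)) := by
    rw [measurable_pi_iff]
    rintro ((kl | _) | (k | l)) <;> simp only [TT, Sum.elim_inl, Sum.elim_inr] <;> fun_prop
  refine ⟨hm, ?_⟩
  symm
  refine Measure.pi_eq fun s hs => ?_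
  rw [Measure.map_apply hm (MeasurableSet.univ_pi hs)]
  have : TT ⁻¹' (Set.univ.pi s) =
      ((Set.univ.pi fun k => Set.univ.pi fun l => s (.inl (.inl (k, l)))) ×ˢ s (.inl (.inr ()))) ×ˢ
      ((Set.univ.pi fun k => s (.inr (.inl k))) ×ˢ (Set.univ.pi fun k => s (.inr (.inr k)))) := by
    ext ω
    simp [TT, Set.mem_pi]
    intro _ _ _
    exact ⟨fun h => h (), fun h _ => h⟩
  rw [this, Measure.prod_prod, Measure.prod_prod, Measure.prod_prod, matrixGaussian]
  simp only [Measure.pi_pi, Fintype.prod_sum_type, Fintype.prod_prod_type]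
  simp

def XX {I : Type*} {m n : ℕ} (w : I → Fin n → ℝ) (ω : (Fin m → Fin n → ℝ) × ℝ) : I × Option (Fin m) → ℝ :=
  fun j => match j.2 with
  | none => ω.2
  | some k => ∑ l, ω.1 k l * w j.1 l

def YY {I : Type*} {m n : ℕ} (w : I → Fin n → ℝ) (ω : (Fin m → ℝ) × (Fin n → ℝ)) : I × Option (Fin m) → ℝ :=
  fun j => match j.2 with
  | none => ∑ l, ω.2 l * w j.1 l
  | some k => ω.1 k

lemma XX_cont {I : Type*} {m n : ℕ} (w : I → Fin n → ℝ) : Continuous (XX (m := m) w) := by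
  refine continuous_pi ?_
  rintro ⟨i, _ | k⟩ <;> simp only [XX] <;> fun_prop

lemma YY_cont {I : Type*} {m n : ℕ} (w : I → Fin n → ℝ) : Continuous (YY (m := m) w) := by
  refine continuous_pi ?_
  rintro ⟨i, _ | k⟩ <;> simp only [YY] <;> fun_prop

lemma gordon {I : Type*} [Fintype I] [DecidableEq I] {m n : ℕ} (p l : ℝ) (hp : 0 < p) (w : I → Fin n → ℝ)
    (hw : ∀ i, ∑ l, w i l ^ 2 = 1) :
    ∫ ω, FF p l (XX w ω) ∂(μX m n) ≤ ∫ ω, FF p l (YY w ω) ∂(μY m n) := by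
  let A : I × Option (Fin m) → KK m n → ℝ := fun j => match j.2 with
    | none => Sum.elim (Sum.elim (fun _ => 0) (fun _ => 1)) (fun _ => 0)
    | some k => Sum.elim (Sum.elim (fun kl => if kl.1 = k then w j.1 kl.2 else 0) (fun _ => 0)) (fun _ => 0)
  let B : I × Option (Fin m) → KK m n → ℝ := fun j => match j.2 with
    | none => Sum.elim (fun _ => 0) (Sum.elim (fun _ => 0) (fun l => w j.1 l))
    | some k => Sum.elim (fun _ => 0) (Sum.elim (fun k' => if k' = k then 1 else 0) (fun _ => 0))
  have h := abstract_gordon p l hp A B (fun i i' => ∑ l, w i l * w i' l) ?_ ?_ ?_ ?_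
  · have mp := TT_mp m n
    have tr : ∀ f : (KK m n → ℝ) → ℝ, Continuous f → ∫ z, f z ∂(Measure.pi fun _ : KK m n => γ₁) =
        ∫ ω, f (TT ω) ∂((μX m n).prod (μY m n)) := by
      intro f hf
      conv_lhs => rw [← mp.map_eq]
      rw [integral_map mp.aemeasurable hf.aestronglyMeasurable]
    rw [tr (fun z => FF p l (fun j => ∑ k, A j k * z k)) ((FF_cont p l).comp (by fun_prop)),
      tr (fun z => FF p l (fun j => ∑ k, B j k * z k)) ((FF_cont p l).comp (by fun_prop))] at h
    have eA : ∀ ω : ((Fin m → Fin n → ℝ) × ℝ) × ((Fin m → ℝ) × (Fin n → ℝ)),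
        (fun j => ∑ k, A j k * TT ω k) = XX w ω.1 := by
      intro ω; funext ⟨i, a⟩
      cases a with
      | none => simp [A, TT, XX]
      | some k =>
        simp [A, TT, XX, Fintype.sum_prod_type]
        exact Finset.sum_congr rfl fun l _ => mul_comm _ _
    have eB : ∀ ω : ((Fin m → Fin n → ℝ) × ℝ) × ((Fin m → ℝ) × (Fin n → ℝ)),
        (fun j => ∑ k, B j k * TT ω k) = YY w ω.2 := by
      intro ω; funext ⟨i, a⟩
      cases a with
      | none => simp [B, TT, YY, mul_comm]
      | some k => simp [B, TT, YY]
    simp_rw [eA, eB] at h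
    rw [integral_fun_fst (fun ω => FF p l (XX w ω)), integral_fun_snd (fun ω => FF p l (YY w ω))] at h
    simpa using h
  · intro i i'
    have h1 := hw i
    have h2 := hw i'
    have : ∑ l, w i l * w i' l ≤ ∑ l, (w i l ^ 2 + w i' l ^ 2) / 2 :=
      Finset.sum_le_sum fun k _ => by nlinarith [sq_nonneg (w i k - w i' k)]
    rw [← Finset.sum_div, Finset.sum_add_distrib] at this
    linarith
  · intro i; simpa [sq] using hw i
  · rintro ⟨i, _ | k⟩ ⟨i', _ | k'⟩ <;> simp [A, B]
  · rintro i (_ | k) i' (_ | k')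
    · simp [A, B]
    · simp [A, B]
    · simp [A, B]
    · simp only [A, B, Fintype.sum_sum_type, Fintype.sum_prod_type, Sum.elim_inl, Sum.elim_inr]
      by_cases hk : k = k'
      · subst hk
        simp
      · have hk' : ¬ k' = k := fun h => hk h.symm
        simp [hk, hk']



lemma gordon_prob {I : Type*} [Fintype I] {m n : ℕ} (l : ℝ) (w : I → Fin n → ℝ)
    (hw : ∀ i, ∑ l, w i l ^ 2 = 1) (f : (Fin m → ℝ) × (Fin n → ℝ) → ℝ) (hf : Integrable f (μY m n))
    (hf0 : ∀ ω, 0 ≤ f ω)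
    (hf1 : ∀ g h, (∃ i, Real.sqrt (∑ k, g k ^ 2) + ∑ j, h j * w i j + l ≤ 1) → 1 ≤ f (g, h)) :
    (μX m n).real {ω | ∃ i, rr (fun a => XX w ω (i, a)) + ω.2 + l ≤ 0} ≤ 2 * ∫ ω, f ω ∂(μY m n) := by
  classical
  set EX := {ω : (Fin m → Fin n → ℝ) × ℝ | ∃ i, rr (fun a => XX w ω (i, a)) + ω.2 + l ≤ 0} with hEX
  have rc : Continuous (rr (m := m)) := by unfold rr; fun_prop
  have hEXm : MeasurableSet EX := by
    have : EX = ⋃ i, {ω | rr (fun a => XX w ω (i, a)) + ω.2 + l ≤ 0} := by ext; simp [hEX]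
    rw [this]
    refine MeasurableSet.iUnion fun i => (isClosed_le ?_ continuous_const).measurableSet
    have : Continuous fun ω : (Fin m → Fin n → ℝ) × ℝ => rr (fun a => XX w ω (i, a)) :=
      rc.comp (continuous_pi fun a => (continuous_apply _).comp (XX_cont w))
    fun_prop
  have main : ∀ p : ℝ, 0 < p → (μX m n).real EX * (1/2) ≤ ∫ ω, f ω ∂(μY m n) + Fintype.card I * Real.exp (-p) := by
    intro p hp
    have iX : Integrable (fun ω => FF p l (XX w ω)) (μX m n) :=
      Integrable.of_bound ((FF_cont p l).comp (XX_cont w)).aestronglyMeasurable 1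
        (Filter.Eventually.of_forall fun ω => by
          rw [Real.norm_eq_abs, abs_of_nonneg (FF_bd p l _).1]; exact (FF_bd p l _).2)
    have iY : Integrable (fun ω => FF p l (YY w ω)) (μY m n) :=
      Integrable.of_bound ((FF_cont p l).comp (YY_cont w)).aestronglyMeasurable 1
        (Filter.Eventually.of_forall fun ω => by
          rw [Real.norm_eq_abs, abs_of_nonneg (FF_bd p l _).1]; exact (FF_bd p l _).2)
    calc (μX m n).real EX * (1/2) = ∫ ω, EX.indicator (fun _ => (1/2 : ℝ)) ω ∂(μX m n) := by
          rw [integral_indicator_const _ hEXm, smul_eq_mul]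
      _ ≤ ∫ ω, FF p l (XX w ω) ∂(μX m n) := by
          refine integral_mono ((integrable_const _).indicator hEXm) iX fun ω => ?_
          by_cases h : ω ∈ EX
          · simp only [Set.indicator_of_mem h]
            obtain ⟨i, hi⟩ := h
            have h1 : 1 ≤ yy p l i (XX w ω) := by
              unfold yy
              refine Real.one_le_exp ?_
              have : XX w ω (i, none) = ω.2 := rfl
              rw [this]; nlinarith
            have h2 := yq_le p l i (XX w ω)
            have h3 := qq_pos p l (XX w ω)
            have h4 : yy p l i (XX w ω) ≤ ∑ i, yy p l i (XX w ω) :=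
              Finset.single_le_sum (fun i _ => (yy_pos p l i _).le) (Finset.mem_univ i)
            have h5 : qq p l (XX w ω) ≤ 1 / 2 := by
              unfold qq
              rw [one_div]
              exact inv_anti₀ (by norm_num) (by linarith)
            unfold FF; linarith
          · simp only [Set.indicator_of_notMem h]
            exact (FF_bd p l _).1
      _ ≤ ∫ ω, FF p l (YY w ω) ∂(μY m n) := gordon p l hp w hw
      _ ≤ ∫ ω, (f ω + Fintype.card I * Real.exp (-p)) ∂(μY m n) := by
          refine integral_mono iY (hf.add (integrable_const _)) fun ω => ?_
          have hc : (0:ℝ) ≤ Fintype.card I * Real.exp (-p) := by positivity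
          by_cases h : ∃ i, Real.sqrt (∑ k, ω.1 k ^ 2) + ∑ j, ω.2 j * w i j + l ≤ 1
          · have := hf1 ω.1 ω.2 h
            have h2 := (FF_bd p l (YY w ω)).2
            simp only [Prod.mk.eta] at this
            simp only; linarith
          · push Not at h
            have h1 : ∀ i, yy p l i (YY w ω) ≤ Real.exp (-p) := by
              intro i
              unfold yy
              refine Real.exp_le_exp.2 ?_
              have e1 : YY w ω (i, none) = ∑ j, ω.2 j * w i j := rfl
              have e2 : Real.sqrt (∑ k, ω.1 k ^ 2) ≤ rr (fun a => YY w ω (i, a)) := by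
                unfold rr
                refine Real.sqrt_le_sqrt ?_
                have : ∀ k : Fin m, YY w ω (i, some k) = ω.1 k := fun k => rfl
                simp only [this]; linarith
              rw [e1]
              nlinarith [h i]
            have h2 : ∑ i, yy p l i (YY w ω) ≤ Fintype.card I * Real.exp (-p) := by
              refine (Finset.sum_le_sum fun i _ => h1 i).trans ?_
              simp
            have h3 : FF p l (YY w ω) ≤ ∑ i, yy p l i (YY w ω) := by
              have h0 := sumyy p l (YY w ω)
              unfold FF qq
              have h6 : 1 - ∑ i, yy p l i (YY w ω) ≤ (1 + ∑ i, yy p l i (YY w ω))⁻¹ := by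
                rw [← one_div, le_div_iff₀ (by linarith)]
                nlinarith
              linarith
            have := hf0 ω
            simp only; linarith
      _ = _ := by
          rw [integral_add hf (integrable_const _)]; simp
  have lim : Filter.Tendsto (fun p : ℝ => ∫ ω, f ω ∂(μY m n) + Fintype.card I * Real.exp (-p)) Filter.atTop
      (nhds (∫ ω, f ω ∂(μY m n) + Fintype.card I * 0)) :=
    (Real.tendsto_exp_neg_atTop_nhds_zero.const_mul _).const_add _
  have := ge_of_tendsto lim (Filter.eventually_atTop.2 ⟨1, fun p hp => main p (by linarith)⟩)
  simp at this
  linarith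

lemma bad_bound {m n : ℕ} (S : Set (Fin n → ℝ)) (hS : IsCompact S) (h1 : ∀ w ∈ S, ∑ i, w i ^ 2 = 1)
    (l : ℝ) (f : (Fin m → ℝ) × (Fin n → ℝ) → ℝ) (hf : Integrable f (μY m n)) (hf0 : ∀ ω, 0 ≤ f ω)
    (hf1 : ∀ g h, (∃ w ∈ S, Real.sqrt (∑ k, g k ^ 2) + ∑ j, h j * w j + l ≤ 1) → 1 ≤ f (g, h)) :
    matrixGaussian m n {A | ∃ w ∈ S, ∀ k, ∑ j, A k j * w j = 0} * γ₁ (Set.Iic (-l - 2)) ≤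
      ENNReal.ofReal (2 * ∫ ω, f ω ∂(μY m n)) := by
  set Bad := fun R : ℕ => {A : Fin m → Fin n → ℝ | (∀ k j, |A k j| ≤ R) ∧ ∃ w ∈ S, ∀ k, ∑ j, A k j * w j = 0}
    with hBad
  have hU : {A : Fin m → Fin n → ℝ | ∃ w ∈ S, ∀ k, ∑ j, A k j * w j = 0} = ⋃ R, Bad R := by
    ext A
    simp only [hBad, Set.mem_iUnion, Set.mem_ofPred_eq]
    constructor
    · intro h
      obtain ⟨R, hR⟩ := exists_nat_ge (∑ k, ∑ j, |A k j|)
      refine ⟨R, fun k j => le_trans ?_ hR, h⟩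
      refine le_trans ?_ (Finset.single_le_sum (f := fun k => ∑ j, |A k j|) (fun k _ => Finset.sum_nonneg fun j _ => abs_nonneg _) (Finset.mem_univ k))
      exact Finset.single_le_sum (f := fun j => |A k j|) (fun j _ => abs_nonneg _) (Finset.mem_univ j)
    · rintro ⟨R, _, h⟩; exact h
  have hmono : Monotone Bad := by
    intro R R' hR A hA
    exact ⟨fun k j => (hA.1 k j).trans (by exact_mod_cast hR), hA.2⟩
  rw [hU, hmono.measure_iUnion, ENNReal.iSup_mul]
  refine iSup_le fun R => ?_
  rw [← Measure.prod_prod]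
  -- net
  obtain ⟨e, he, hee⟩ : ∃ e : ℝ, 0 < e ∧ m * (n * R * e) ^ 2 ≤ 1 := by
    refine ⟨1 / ((m + 1) * (n * R + 1)), by positivity, ?_⟩
    have hm : (0:ℝ) ≤ m := by positivity
    have hn : (0:ℝ) ≤ (n:ℝ) * R := by positivity
    have : (n:ℝ) * R * (1 / ((m + 1) * (n * R + 1))) ≤ 1 / (m + 1) := by
      rw [mul_one_div, div_le_div_iff₀ (by positivity) (by positivity)]
      nlinarith
    calc (m:ℝ) * (n * R * (1 / ((m + 1) * (n * R + 1)))) ^ 2 ≤ m * (1 / (m + 1)) ^ 2 := by gcongr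
      _ ≤ 1 := by
        rw [one_div, inv_pow, ← div_eq_mul_inv, div_le_one (by positivity)]; nlinarith
  obtain ⟨t, htS, htf, htc⟩ := hS.finite_cover_balls he
  have : Fintype t := htf.fintype
  have key := gordon_prob (m := m) l (fun i : t => (i : Fin n → ℝ)) (fun i => h1 _ (htS i.2)) f hf hf0
    (fun g h ⟨i, hi⟩ => hf1 g h ⟨i, htS i.2, hi⟩)
  refine le_trans ?_ (ENNReal.ofReal_le_ofReal key)
  rw [measureReal_def, ENNReal.ofReal_toReal (measure_ne_top _ _)]
  refine measure_mono ?_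
  rintro ⟨A, g0⟩ ⟨⟨hA, w, hw, hAw⟩, hg⟩
  simp only [Set.mem_Iic] at hg
  obtain ⟨i, hit, hi⟩ := Set.mem_iUnion₂.1 (htc hw)
  refine ⟨⟨i, hit⟩, ?_⟩
  simp only
  have hd : ∀ j, |i j - w j| ≤ e := by
    intro j
    have := (dist_pi_lt_iff he).1 (Metric.mem_ball.1 hi) j
    rw [dist_comm, Real.dist_eq] at this; exact this.le
  have hr : rr (fun a => XX (fun i : t => (i : Fin n → ℝ)) (A, g0) (⟨i, hit⟩, a)) ≤ 2 := by
    unfold rr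
    rw [Real.sqrt_le_left (by norm_num)]
    have hk : ∀ k, XX (fun i : t => (i : Fin n → ℝ)) (A, g0) (⟨i, hit⟩, some k) ^ 2 ≤ (n * R * e) ^ 2 := by
      intro k
      have e1 : XX (fun i : t => (i : Fin n → ℝ)) (A, g0) (⟨i, hit⟩, some k) = ∑ j, A k j * i j := rfl
      have e2 : ∑ j, A k j * i j = ∑ j, A k j * (i j - w j) := by
        simp_rw [mul_sub]; rw [Finset.sum_sub_distrib, hAw k, sub_zero]
      rw [e1, e2, ← sq_abs]
      refine pow_le_pow_left₀ (abs_nonneg _) ?_ 2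
      refine (Finset.abs_sum_le_sum_abs _ _).trans ?_
      have : ∀ j ∈ Finset.univ, |A k j * (i j - w j)| ≤ R * e := by
        intro j _
        rw [abs_mul]
        exact mul_le_mul (hA k j) (hd j) (abs_nonneg _) (by positivity)
      refine (Finset.sum_le_sum this).trans ?_
      simp [mul_assoc]
    have := Finset.sum_le_sum (s := Finset.univ) fun k _ => hk k
    simp only [Finset.sum_const, Finset.card_univ, Fintype.card_fin, nsmul_eq_mul] at this
    linarith
  linarith



lemma int_sq : Integrable fun t : ℝ => Real.exp (-t ^ 2) := by
  simpa using integrable_exp_neg_mul_sq (b := 1) one_pos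

lemma int_Ioi_sq (u : ℝ) : ∫ t in Set.Ioi u, Real.exp (-t ^ 2) = Real.sqrt Real.pi / 2 * (1 - erf u) := by
  have h0 : ∫ t in Set.Ioi (0:ℝ), Real.exp (-t ^ 2) = Real.sqrt Real.pi / 2 := by
    simpa using integral_gaussian_Ioi 1
  have := intervalIntegral.integral_interval_add_Ioi (a := 0) (b := u) int_sq.integrableOn int_sq.integrableOn
  rw [h0] at this
  unfold erf
  have hp : Real.sqrt Real.pi ≠ 0 := by positivity
  field_simp
  linarith

lemma erf_neg (u : ℝ) : erf (-u) = - erf u := by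
  unfold erf
  have : ∫ t in (0:ℝ)..-u, Real.exp (-t ^ 2) = -∫ t in (0:ℝ)..u, Real.exp (-t ^ 2) := by
    have := intervalIntegral.integral_comp_neg (a := 0) (b := u) (fun t : ℝ => Real.exp (-t ^ 2))
    simp only [neg_sq, neg_zero] at this
    rw [this, intervalIntegral.integral_symm]
  rw [this]; ring

lemma int_sh (k p : ℝ) (hk : 0 < k) : Integrable fun t : ℝ => Real.exp (-(k * (t - p)) ^ 2) :=
  (int_sq.comp_mul_left' hk.ne').comp_sub_right p

lemma gau_tail (k p v : ℝ) (hk : 0 < k) : ∫ t in Set.Ioi v, Real.exp (-(k * (t - p)) ^ 2) =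
    k⁻¹ * (Real.sqrt Real.pi / 2 * (1 - erf (k * (v - p)))) := by
  have e1 : ∫ t in Set.Ioi v, Real.exp (-(k * (t - p)) ^ 2) =
      ∫ t in Set.Ioi (v - p), Real.exp (-(k * t) ^ 2) := by
    rw [← integral_indicator measurableSet_Ioi, ← integral_indicator measurableSet_Ioi,
      ← integral_sub_right_eq_self (μ := volume)
        (Set.indicator (Set.Ioi (v - p)) fun t => Real.exp (-(k * t) ^ 2)) p]
    congr 1; ext t
    simp [Set.indicator]
  rw [e1, integral_comp_mul_left_Ioi (fun t => Real.exp (-t ^ 2)) _ hk, int_Ioi_sq, smul_eq_mul]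

lemma gpdf_abs (x : ℝ) : gaussianPDFReal 0 1 |x| = gaussianPDFReal 0 1 x := by
  rw [gpdf_eq, gpdf_eq, sq_abs]

lemma int_gauss_abs (f : ℝ → ℝ) : ∫ x, f |x| ∂γ₁ = 2 * ∫ x in Set.Ioi (0:ℝ), gaussianPDFReal 0 1 x * f x := by
  rw [integral_gaussianReal_eq_integral_smul (by norm_num), ← integral_comp_abs (f := fun x => gaussianPDFReal 0 1 x * f x)]
  simp only [gpdf_abs, smul_eq_mul]

lemma one_pt (b ν : ℝ) (hb : b < 1 / 2) (x : ℝ) :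
    gaussianPDFReal 0 1 x * Real.exp (b * (x + ν) ^ 2) =
      (Real.sqrt (2 * Real.pi))⁻¹ * Real.exp (b * ν ^ 2 / (1 - 2 * b)) *
        Real.exp (-(Real.sqrt ((1 - 2 * b) / 2) * (x - 2 * b * ν / (1 - 2 * b))) ^ 2) := by
  have ha : 0 < 1 - 2 * b := by linarith
  rw [gpdf_eq, mul_assoc, mul_assoc, ← Real.exp_add, ← Real.exp_add, mul_pow, Real.sq_sqrt (by positivity)]
  congr 2
  field_simp
  ring

lemma intble1 (b ν : ℝ) (hb : b < 1 / 2) : Integrable (fun x => Real.exp (b * (|x| + ν) ^ 2)) γ₁ := by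
  have ha : 0 < 1 - 2 * b := by linarith
  rw [integrable_gauss_iff]
  have hk : 0 < Real.sqrt ((1 - 2 * b) / 2) := by positivity
  refine Integrable.mono' (g := fun x => (Real.sqrt (2 * Real.pi))⁻¹ * Real.exp (b * ν ^ 2 / (1 - 2 * b)) *
        (Real.exp (-(Real.sqrt ((1 - 2 * b) / 2) * (x - 2 * b * ν / (1 - 2 * b))) ^ 2) +
        Real.exp (-(Real.sqrt ((1 - 2 * b) / 2) * (x - -(2 * b * ν / (1 - 2 * b)))) ^ 2)))
    (((int_sh _ _ hk).add (int_sh _ _ hk)).const_mul _) ?_ ?_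
  · have : gaussianPDFReal 0 1 = fun x => (Real.sqrt (2 * Real.pi))⁻¹ * Real.exp (-x ^ 2 / 2) :=
      funext gpdf_eq
    rw [this]
    exact (by fun_prop : Continuous _).aestronglyMeasurable
  · refine Filter.Eventually.of_forall fun x => ?_
    rw [Real.norm_of_nonneg (mul_nonneg (gaussianPDFReal_nonneg _ _ _) (Real.exp_pos _).le),
      ← gpdf_abs, one_pt b ν hb]
    refine mul_le_mul_of_nonneg_left ?_ (by positivity)
    rcases abs_cases x with ⟨h, _⟩ | ⟨h, _⟩ <;> rw [h]
    · have := Real.exp_pos (-(Real.sqrt ((1 - 2 * b) / 2) * (x - -(2 * b * ν / (1 - 2 * b)))) ^ 2)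
      linarith
    · have := Real.exp_pos (-(Real.sqrt ((1 - 2 * b) / 2) * (x - (2 * b * ν / (1 - 2 * b)))) ^ 2)
      have e : (Real.sqrt ((1 - 2 * b) / 2) * (-x - (2 * b * ν / (1 - 2 * b)))) ^ 2 =
        (Real.sqrt ((1 - 2 * b) / 2) * (x - -(2 * b * ν / (1 - 2 * b)))) ^ 2 := by ring
      rw [e]; linarith

lemma intble2 (b ν : ℝ) (hb0 : 0 ≤ b) (hν : 0 ≤ ν) (hb : b < 1 / 2) :
    Integrable (fun x => Real.exp (b * (max (|x| - ν) 0) ^ 2)) γ₁ := by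
  refine (intble1 b ν hb).mono' (by fun_prop : Continuous _).aestronglyMeasurable
    (Filter.Eventually.of_forall fun x => ?_)
  rw [Real.norm_of_nonneg (Real.exp_pos _).le]
  refine Real.exp_le_exp.2 (mul_le_mul_of_nonneg_left ?_ hb0)
  refine pow_le_pow_left₀ (le_max_right _ _) (max_le ?_ ?_) 2
  · linarith
  · positivity

lemma val1 (c γ ν : ℝ) (hc : 0 < c) (hγ : c / 2 < γ) :
    ∫ x, Real.exp (c / (4 * γ) * (|x| + ν) ^ 2) ∂γ₁ = I1 c γ ν := by
  have hb : c / (4 * γ) < 1 / 2 := by rw [div_lt_div_iff₀ (by linarith) (by norm_num)]; linarith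
  unfold I1
  generalize c / (4 * γ) = b at *
  have ha : 0 < 1 - 2 * b := by linarith
  have hk : 0 < Real.sqrt ((1 - 2 * b) / 2) := by positivity
  rw [int_gauss_abs (fun y => Real.exp (b * (y + ν) ^ 2))]
  simp only [one_pt b ν hb]
  rw [integral_const_mul, gau_tail _ _ _ hk]
  have e1 : Real.sqrt ((1 - 2 * b) / 2) * (0 - 2 * b * ν / (1 - 2 * b)) =
      - (Real.sqrt 2 * b * ν / Real.sqrt (1 - 2 * b)) := by
    rw [Real.sqrt_div ha.le]
    have h2 : Real.sqrt 2 ^ 2 = 2 := Real.sq_sqrt (by norm_num)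
    have h3 : Real.sqrt (1 - 2 * b) ^ 2 = 1 - 2 * b := Real.sq_sqrt ha.le
    have h4 : Real.sqrt (1 - 2 * b) ≠ 0 := by positivity
    generalize Real.sqrt (1 - 2 * b) = s at *
    rw [← h3]
    field_simp
    rw [h2]; ring
  rw [e1, erf_neg, Real.sqrt_div ha.le, Real.sqrt_mul (by norm_num)]
  have h4 : Real.sqrt (1 - 2 * b) ≠ 0 := by positivity
  field_simp
  ring

lemma two_pt (b ν : ℝ) (hb : b < 1 / 2) (x : ℝ) (hx : ν < x) :
    gaussianPDFReal 0 1 x * Real.exp (b * (max (x - ν) 0) ^ 2) =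
      (Real.sqrt (2 * Real.pi))⁻¹ * Real.exp (b * ν ^ 2 / (1 - 2 * b)) *
        Real.exp (-(Real.sqrt ((1 - 2 * b) / 2) * (x - -(2 * b * ν / (1 - 2 * b)))) ^ 2) := by
  have := one_pt b (-ν) hb x
  rw [max_eq_left (by linarith), sub_eq_add_neg, this]
  congr 3
  · ring
  · ring

lemma val2 (c γ ν : ℝ) (hc : 0 < c) (hγ : c / 2 < γ) (hν : 0 ≤ ν) :
    ∫ x, Real.exp (c / (4 * γ) * (max (|x| - ν) 0) ^ 2) ∂γ₁ = I2 c γ ν := by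
  have hb : c / (4 * γ) < 1 / 2 := by rw [div_lt_div_iff₀ (by linarith) (by norm_num)]; linarith
  have hb0 : 0 ≤ c / (4 * γ) := by have : 0 < γ := by linarith
                                   positivity
  unfold I2
  generalize c / (4 * γ) = b at *
  have ha : 0 < 1 - 2 * b := by linarith
  have hk : 0 < Real.sqrt ((1 - 2 * b) / 2) := by positivity
  have hint := (integrable_gauss_iff _).1 (intble2 b ν hb0 hν hb)
  have hintOn : IntegrableOn (fun x => gaussianPDFReal 0 1 x * Real.exp (b * (max (x - ν) 0) ^ 2)) (Set.Ioi 0) := by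
    refine (hint.integrableOn (s := Set.Ioi 0)).congr_fun (fun x hx => ?_) measurableSet_Ioi
    simp only [abs_of_pos (Set.mem_Ioi.1 hx)]
  rw [int_gauss_abs (fun y => Real.exp (b * (max (y - ν) 0) ^ 2)),
    ← intervalIntegral.integral_interval_add_Ioi hintOn (hintOn.mono_set (Set.Ioi_subset_Ioi hν)),
    setIntegral_congr_fun measurableSet_Ioi (fun x hx => two_pt b ν hb x hx),
    integral_const_mul, gau_tail _ _ _ hk]
  have e0 : ∫ x in (0:ℝ)..ν, gaussianPDFReal 0 1 x * Real.exp (b * (max (x - ν) 0) ^ 2) = erf (ν / Real.sqrt 2) / 2 := by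
    have : ∫ x in (0:ℝ)..ν, gaussianPDFReal 0 1 x * Real.exp (b * (max (x - ν) 0) ^ 2) =
        ∫ x in (0:ℝ)..ν, (Real.sqrt (2 * Real.pi))⁻¹ * Real.exp (-(x / Real.sqrt 2) ^ 2) := by
      refine intervalIntegral.integral_congr fun x hx => ?_
      rw [Set.uIcc_of_le hν] at hx
      rw [max_eq_right (by linarith [hx.2]), gpdf_eq, div_pow, Real.sq_sqrt (by norm_num)]
      simp [neg_div]
    rw [this, intervalIntegral.integral_const_mul,
      intervalIntegral.integral_comp_div (fun x => Real.exp (-x ^ 2)) (by positivity : Real.sqrt 2 ≠ 0)]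
    unfold erf
    rw [zero_div, smul_eq_mul, Real.sqrt_mul (by norm_num)]
    field_simp
  have e1 : Real.sqrt ((1 - 2 * b) / 2) * (ν - -(2 * b * ν / (1 - 2 * b))) =
      ν / Real.sqrt (2 * (1 - 2 * b)) := by
    rw [Real.sqrt_div ha.le, Real.sqrt_mul (by norm_num)]
    have h3 : Real.sqrt (1 - 2 * b) ^ 2 = 1 - 2 * b := Real.sq_sqrt ha.le
    have h4 : Real.sqrt (1 - 2 * b) ≠ 0 := by positivity
    have : ν - -(2 * b * ν / (1 - 2 * b)) = ν / (1 - 2 * b) := by field_simp; ring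
    rw [this]
    generalize Real.sqrt (1 - 2 * b) = s at *
    rw [← h3]
    field_simp
  rw [e0, e1, Real.sqrt_div ha.le, Real.sqrt_mul (by norm_num) Real.pi]
  have h4 : Real.sqrt (1 - 2 * b) ≠ 0 := by positivity
  unfold erfc
  field_simp
  ring

lemma one_le_int (f : ℝ → ℝ) (hf : Integrable f γ₁) (h : ∀ x, 1 ≤ f x) : 1 ≤ ∫ x, f x ∂γ₁ := by
  have := integral_mono (integrable_const (1:ℝ)) hf h
  simpa using this

lemma blt {c γ : ℝ} (hc : 0 < c) (hγ : c / 2 < γ) : c / (4 * γ) < 1 / 2 := by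
  rw [div_lt_div_iff₀ (by linarith) (by norm_num)]; linarith

lemma bnn {c γ : ℝ} (hc : 0 < c) (hγ : c / 2 < γ) : 0 ≤ c / (4 * γ) := by
  have : 0 < γ := by linarith
  positivity

lemma I1_ge (c γ ν : ℝ) (hc : 0 < c) (hγ : c / 2 < γ) : 1 ≤ I1 c γ ν := by
  rw [← val1 c γ ν hc hγ]
  refine one_le_int _ (intble1 _ _ (blt hc hγ)) fun x => Real.one_le_exp ?_
  have := bnn hc hγ
  positivity

lemma I2_ge (c γ ν : ℝ) (hc : 0 < c) (hγ : c / 2 < γ) (hν : 0 ≤ ν) : 1 ≤ I2 c γ ν := by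
  rw [← val2 c γ ν hc hγ hν]
  refine one_le_int _ (intble2 _ _ (bnn hc hγ) hν (blt hc hγ)) fun x => Real.one_le_exp ?_
  have := bnn hc hγ
  positivity

lemma val0 (s : ℝ) (hs : 0 ≤ s) : ∫ x, Real.exp (-s * x ^ 2) ∂γ₁ = (Real.sqrt (1 + 2 * s))⁻¹ := by
  rw [integral_gaussianReal_eq_integral_smul (by norm_num)]
  have : ∀ x : ℝ, gaussianPDFReal 0 1 x • Real.exp (-s * x ^ 2) =
      (Real.sqrt (2 * Real.pi))⁻¹ * Real.exp (-((1 + 2 * s) / 2) * x ^ 2) := by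
    intro x
    rw [gpdf_eq, smul_eq_mul, mul_assoc, ← Real.exp_add]
    congr 2; ring
  simp only [this]
  rw [integral_const_mul, integral_gaussian]
  have : Real.pi / ((1 + 2 * s) / 2) = 2 * Real.pi / (1 + 2 * s) := by field_simp
  rw [this, Real.sqrt_div (by positivity)]
  have : Real.sqrt (2 * Real.pi) ≠ 0 := by positivity
  field_simp

lemma tail_lb (l : ℝ) (hl : 0 ≤ l) :
    ENNReal.ofReal ((Real.sqrt (2 * Real.pi))⁻¹ * Real.exp (-(l + 3) ^ 2 / 2)) ≤ γ₁ (Set.Iic (-l - 2)) := by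
  have h : γ₁ (Set.Icc (-l - 3) (-l - 2)) ≤ γ₁ (Set.Iic (-l - 2)) := measure_mono fun x hx => hx.2
  refine le_trans ?_ h
  rw [gaussianReal_apply _ (by norm_num)]
  calc ENNReal.ofReal ((Real.sqrt (2 * Real.pi))⁻¹ * Real.exp (-(l + 3) ^ 2 / 2))
      = ∫⁻ x in Set.Icc (-l - 3) (-l - 2), ENNReal.ofReal ((Real.sqrt (2 * Real.pi))⁻¹ * Real.exp (-(l + 3) ^ 2 / 2)) := by
        rw [setLIntegral_const, Real.volume_Icc]
        have : -l - 2 - (-l - 3) = 1 := by ring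
        rw [this]; simp
    _ ≤ _ := by
        refine setLIntegral_mono' measurableSet_Icc fun x hx => ?_
        rw [gaussianPDF, gpdf_eq]
        refine ENNReal.ofReal_le_ofReal (mul_le_mul_of_nonneg_left (Real.exp_le_exp.2 ?_) (by positivity))
        nlinarith [hx.1, hx.2]



lemma sph_key (c α ρ : ℝ) (hc : 0 < c) (hα : 0 < α) (hρ : 0 < ρ) :
    -c * ρ + (α - ρ ^ 2) / 2 - α / 2 * Real.log (α / ρ ^ 2) ≤ c * Isph c α := by
  set q := Real.sqrt (4 * c ^ 2 + 16 * α) with hq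
  have hq2 : q ^ 2 = 4 * c ^ 2 + 16 * α := Real.sq_sqrt (by positivity)
  have hqc : 2 * c < q := by
    refine Real.lt_sqrt_of_sq_lt ?_
    nlinarith
  obtain ⟨s, hs⟩ : ∃ s, s = (q - 2 * c) / 4 := ⟨_, rfl⟩
  have hs0 : 0 < s := by rw [hs]; linarith
  have hsα : α = s ^ 2 + c * s := by rw [hs]; nlinarith
  have e1 : (2 * c - q) / 8 = - s / 2 := by rw [hs]; ring
  have e2 : 1 - c / (2 * (-s / 2)) = α / s ^ 2 := by
    rw [hsα]; field_simp; ring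
  have e3 : c * Isph c α = - c * s / 2 - α / 2 * Real.log (α / s ^ 2) := by
    unfold Isph
    rw [← hq, e1, e2]; field_simp
  rw [e3, Real.log_div hα.ne' (by positivity), Real.log_div hα.ne' (by positivity), Real.log_pow, Real.log_pow]
  have h1 := Real.log_le_sub_one_of_pos (div_pos hρ hs0)
  rw [Real.log_div hρ.ne' hs0.ne'] at h1
  have h2 : α * (Real.log ρ - Real.log s) ≤ α * (ρ / s - 1) := mul_le_mul_of_nonneg_left h1 hα.le
  have h3 : α * (ρ / s - 1) = (s + c) * (ρ - s) := by rw [hsα]; field_simp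
  push_cast
  nlinarith [sq_nonneg (ρ - s)]

lemma gg_int {m : ℕ} (s : ℝ) (hs : 0 ≤ s) :
    Integrable (fun g : Fin m → ℝ => Real.exp (-s * ∑ k, g k ^ 2)) (Measure.pi fun _ : Fin m => γ₁) := by
  refine Integrable.of_bound (by fun_prop : Continuous _).aestronglyMeasurable 1 (Filter.Eventually.of_forall fun g => ?_)
  rw [Real.norm_of_nonneg (Real.exp_pos _).le]
  refine Real.exp_le_one_iff.2 ?_
  have : 0 ≤ ∑ k, g k ^ 2 := Finset.sum_nonneg fun k _ => sq_nonneg _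
  nlinarith

lemma gg_val {m : ℕ} (s : ℝ) (hs : 0 ≤ s) :
    ∫ g : Fin m → ℝ, Real.exp (-s * ∑ k, g k ^ 2) ∂(Measure.pi fun _ : Fin m => γ₁) =
      Real.exp (-(m / 2) * Real.log (1 + 2 * s)) := by
  have : ∀ g : Fin m → ℝ, Real.exp (-s * ∑ k, g k ^ 2) = ∏ k, Real.exp (-s * g k ^ 2) := by
    intro g; rw [← Real.exp_sum, Finset.mul_sum]
  simp only [this]
  rw [integral_fintype_prod_eq_prod (𝕜 := ℝ) (fun (_ : Fin m) (x : ℝ) => Real.exp (-s * x ^ 2))]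
  simp only [val0 s hs, Finset.prod_const, Finset.card_univ, Fintype.card_fin]
  have h1 : 0 < 1 + 2 * s := by linarith
  have : (Real.sqrt (1 + 2 * s))⁻¹ = Real.exp (-(1 / 2) * Real.log (1 + 2 * s)) := by
    rw [Real.sqrt_eq_rpow, Real.rpow_def_of_pos h1, ← Real.exp_neg]; congr 1; ring
  rw [this, ← Real.exp_nat_mul]; congr 1; ring

lemma gr_int {m : ℕ} (s : ℝ) (hs : 0 ≤ s) :
    Integrable (fun g : Fin m → ℝ => Real.exp (-s * Real.sqrt (∑ k, g k ^ 2))) (Measure.pi fun _ : Fin m => γ₁) := by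
  refine Integrable.of_bound (by fun_prop : Continuous _).aestronglyMeasurable 1 (Filter.Eventually.of_forall fun g => ?_)
  rw [Real.norm_of_nonneg (Real.exp_pos _).le]
  refine Real.exp_le_one_iff.2 ?_
  have := Real.sqrt_nonneg (∑ k, g k ^ 2)
  nlinarith

lemma chi_pt (c η r N : ℝ) (hc : 0 < c) (hη : 0 < η) (hN : 0 < N) (hr : 0 ≤ r) (K : ℕ) (s : ℕ → ℝ)
    (hs : ∀ i < K, 0 ≤ s i) :
    Real.exp (-(c * N) * r) ≤ Real.exp (-c * (K * η) * N ^ 2) +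
      ∑ i ∈ Finset.range K, Real.exp (-c * (i * η) * N ^ 2 + s i * (((i + 1) * η) ^ 2 * N ^ 2)) * Real.exp (-s i * r ^ 2) := by
  have hsum : ∀ i ∈ Finset.range K, 0 ≤ Real.exp (-c * (i * η) * N ^ 2 + s i * (((i + 1) * η) ^ 2 * N ^ 2)) * Real.exp (-s i * r ^ 2) :=
    fun i _ => by positivity
  have hmono : ∀ i : ℕ, i * η * N ≤ r → Real.exp (-(c * N) * r) ≤ Real.exp (-c * (i * η) * N ^ 2) := by
    intro i hi
    refine Real.exp_le_exp.2 ?_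
    have := mul_le_mul_of_nonneg_left hi (by positivity : 0 ≤ c * N)
    nlinarith
  by_cases h : K * η * N ≤ r
  · have := Finset.sum_nonneg hsum
    have := hmono K h
    linarith
  · push Not at h
    set i := ⌊r / (η * N)⌋₊ with hi
    have hp : 0 < η * N := by positivity
    have h1 : (i:ℝ) ≤ r / (η * N) := Nat.floor_le (by positivity)
    have h2 : r / (η * N) < i + 1 := Nat.lt_floor_add_one _
    rw [le_div_iff₀ hp] at h1
    rw [div_lt_iff₀ hp] at h2
    have hiK : i < K := by
      have : (i:ℝ) < K := by
        by_contra hh; push Not at hh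
        have := mul_le_mul_of_nonneg_right hh hp.le
        nlinarith
      exact_mod_cast this
    have h3 := Finset.single_le_sum hsum (Finset.mem_range.2 hiK)
    have h4 := Real.exp_pos (-c * (K * η) * N ^ 2)
    have h5 := hmono i (by linarith)
    have h6 : Real.exp (-c * (i * η) * N ^ 2) ≤
        Real.exp (-c * (i * η) * N ^ 2 + s i * (((i + 1) * η) ^ 2 * N ^ 2)) * Real.exp (-s i * r ^ 2) := by
      rw [← Real.exp_add]
      refine Real.exp_le_exp.2 ?_
      have : r ^ 2 ≤ ((i + 1) * (η * N)) ^ 2 := pow_le_pow_left₀ hr h2.le 2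
      have := mul_le_mul_of_nonneg_left this (hs i hiK)
      nlinarith
    linarith

lemma chi_bound (c α : ℝ) (hc : 0 < c) (hα : 0 < α) (K : ℕ) (hK : 0 < K) (n m : ℕ) (hn : 0 < n) (hm : α * n ≤ m) :
    ∫ g : Fin m → ℝ, Real.exp (-(c * Real.sqrt n) * Real.sqrt (∑ k, g k ^ 2)) ∂(Measure.pi fun _ : Fin m => γ₁) ≤
      (K + 1) * Real.exp (n * (c * Isph c α + c * (Real.sqrt α / K))) := by
  set η := Real.sqrt α / K with hηd
  have hKr : (0:ℝ) < K := by exact_mod_cast hK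
  have hnr : (0:ℝ) < n := by exact_mod_cast hn
  have hη : 0 < η := by positivity
  have hKη : K * η = Real.sqrt α := by rw [hηd]; field_simp
  have hN2 : Real.sqrt n ^ 2 = n := Real.sq_sqrt hnr.le
  set s : ℕ → ℝ := fun i => (α / ((i + 1) * η) ^ 2 - 1) / 2 with hsd
  have hs : ∀ i < K, 0 ≤ s i := by
    intro i hi
    have h1 : ((i:ℝ) + 1) * η ≤ Real.sqrt α := by
      rw [← hKη]
      refine mul_le_mul_of_nonneg_right ?_ hη.le
      exact_mod_cast hi
    have h2 : (((i:ℝ) + 1) * η) ^ 2 ≤ α := by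
      rw [← Real.sq_sqrt hα.le]; exact pow_le_pow_left₀ (by positivity) h1 2
    have : 1 ≤ α / (((i:ℝ) + 1) * η) ^ 2 := by rw [le_div_iff₀ (by positivity)]; linarith
    simp only [hsd]; linarith
  have pt := fun g : Fin m → ℝ => chi_pt c η (Real.sqrt (∑ k, g k ^ 2)) (Real.sqrt n) hc hη (by positivity)
    (Real.sqrt_nonneg _) K s hs
  have e : ∀ g : Fin m → ℝ, Real.sqrt (∑ k, g k ^ 2) ^ 2 = ∑ k, g k ^ 2 := fun g =>
    Real.sq_sqrt (Finset.sum_nonneg fun k _ => sq_nonneg _)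
  simp only [e, hN2] at pt
  have hint : ∀ i ∈ Finset.range K, Integrable (fun g : Fin m → ℝ => Real.exp (-c * (i * η) * n + s i * (((i + 1) * η) ^ 2 * n)) * Real.exp (-s i * ∑ k, g k ^ 2)) (Measure.pi fun _ : Fin m => γ₁) :=
    fun i hi => (gg_int _ (hs i (Finset.mem_range.1 hi))).const_mul _
  have step := integral_mono (gr_int (m := m) (c * Real.sqrt n) (by positivity))
    ((integrable_const (Real.exp (-c * (K * η) * n))).add (integrable_finsetSum (Finset.range K) hint)) pt
  refine step.trans ?_
  have e2 : ∫ g : Fin m → ℝ, (Real.exp (-c * (K * η) * n) + ∑ i ∈ Finset.range K, Real.exp (-c * (i * η) * n + s i * (((i + 1) * η) ^ 2 * n)) * Real.exp (-s i * ∑ k, g k ^ 2)) ∂(Measure.pi fun _ : Fin m => γ₁)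
      = Real.exp (-c * (K * η) * n) + ∑ i ∈ Finset.range K, Real.exp (-c * (i * η) * n + s i * (((i + 1) * η) ^ 2 * n)) * Real.exp (-(m / 2) * Real.log (1 + 2 * s i)) := by
    rw [integral_add (integrable_const _) (integrable_finsetSum (Finset.range K) hint), integral_finsetSum _ hint]
    congr 1
    · simp
    · refine Finset.sum_congr rfl fun i hi => ?_
      rw [integral_const_mul, gg_val _ (hs i (Finset.mem_range.1 hi))]
  refine (le_of_eq e2).trans ?_
  set E := Real.exp (n * (c * Isph c α + c * η)) with hE
  have t1 : Real.exp (-c * (K * η) * n) ≤ E := by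
    refine Real.exp_le_exp.2 ?_
    have h1 := sph_key c α (Real.sqrt α) hc hα (by positivity)
    rw [Real.sq_sqrt hα.le, div_self hα.ne'] at h1
    simp only [sub_self, zero_div, add_zero, Real.log_one, mul_zero, sub_zero] at h1
    rw [hKη]
    have : 0 ≤ c * η := by positivity
    have := mul_le_mul_of_nonneg_left h1 hnr.le
    nlinarith
  have t2 : ∀ i ∈ Finset.range K, Real.exp (-c * (i * η) * n + s i * (((i + 1) * η) ^ 2 * n)) * Real.exp (-(m / 2) * Real.log (1 + 2 * s i)) ≤ E := by
    intro i hi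
    have hsi := hs i (Finset.mem_range.1 hi)
    rw [← Real.exp_add]
    refine Real.exp_le_exp.2 ?_
    obtain ⟨ρ, hρ⟩ : ∃ ρ : ℝ, ρ = (i + 1) * η := ⟨_, rfl⟩
    have hρ0 : 0 < ρ := by rw [hρ]; positivity
    have hs1 : 1 + 2 * s i = α / ρ ^ 2 := by rw [hρ]; simp only [hsd]; ring
    have hs2 : s i * ρ ^ 2 = (α - ρ ^ 2) / 2 := by
      rw [hρ]; simp only [hsd]; field_simp
    have hlog : 0 ≤ Real.log (1 + 2 * s i) := Real.log_nonneg (by linarith)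
    have h1 := sph_key c α ρ hc hα hρ0
    have h2 := mul_le_mul_of_nonneg_right hm hlog
    rw [← hs1] at h1
    rw [← hρ, ← mul_assoc (s i), hs2]
    have h3 : (i:ℝ) * η = ρ - η := by rw [hρ]; ring
    rw [h3]
    have := mul_le_mul_of_nonneg_left h1 hnr.le
    nlinarith
  have := Finset.sum_le_sum t2
  simp only [Finset.sum_const, Finset.card_range, nsmul_eq_mul] at this
  linarith



/-- signed comparison set -/
def SS (n k : ℕ) : Set (Fin n → ℝ) :=
  {w | ∑ i, w i ^ 2 = 1 ∧ ∑ i : Fin n, (if (i : ℕ) < n - k then (1:ℝ) else -1) * |w i| ≤ 0}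

lemma SS_compact (n k : ℕ) : IsCompact (SS n k) := by
  refine (isCompact_univ_pi (fun _ : Fin n => isCompact_Icc (a := (-1:ℝ)) (b := 1))).of_isClosed_subset ?_ ?_
  · exact (isClosed_eq (f := fun w : Fin n → ℝ => ∑ i, w i ^ 2) (g := fun _ => 1) (by fun_prop) (by fun_prop)).inter
      (isClosed_le (f := fun w : Fin n → ℝ => ∑ i : Fin n, (if (i : ℕ) < n - k then (1:ℝ) else -1) * |w i|)
        (g := fun _ => 0) (by fun_prop) (by fun_prop))
  · rintro w ⟨h, _⟩ i _
    have := Finset.single_le_sum (f := fun i => w i ^ 2) (fun i _ => sq_nonneg _) (Finset.mem_univ i)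
    simp only [h] at this
    exact abs_le.1 ((sq_le_one_iff_abs_le_one _).1 this)

/-- shrunk or enlarged absolute value -/
noncomputable def tt (n k : ℕ) (ν : ℝ) (i : Fin n) (x : ℝ) : ℝ :=
  if (i : ℕ) < n - k then max (|x| - ν) 0 else |x| + ν

lemma SS_pt (n k : ℕ) (ν : ℝ) (hν : 0 ≤ ν) (w h : Fin n → ℝ) (hw : w ∈ SS n k) :
    -∑ j, h j * w j ≤ Real.sqrt (∑ i, tt n k ν i (h i) ^ 2) := by
  have h1 : ∀ i, -(h i * w i) ≤ tt n k ν i (h i) * |w i| +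
      ν * ((if (i : ℕ) < n - k then (1:ℝ) else -1) * |w i|) := by
    intro i
    have h0 : -(h i * w i) ≤ |h i| * |w i| := by rw [← abs_mul]; exact neg_le_abs _
    refine h0.trans ?_
    have h2 := abs_nonneg (w i)
    unfold tt
    split_ifs
    · have := mul_le_mul_of_nonneg_right (le_max_left (|h i| - ν) 0) h2
      linarith
    · linarith
  have h2 := Finset.sum_le_sum (s := Finset.univ) fun i _ => h1 i
  rw [Finset.sum_add_distrib, ← Finset.mul_sum, Finset.sum_neg_distrib] at h2
  have h3 := mul_nonpos_of_nonneg_of_nonpos hν hw.2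
  have h4 := Real.sum_mul_le_sqrt_mul_sqrt Finset.univ (fun i => tt n k ν i (h i)) (fun i => |w i|)
  simp only [sq_abs, hw.1, Real.sqrt_one, mul_one] at h4
  linarith

lemma tt_int (n k : ℕ) (c γ ν : ℝ) (hc : 0 < c) (hγ : c / 2 < γ) (hν : 0 ≤ ν) (i : Fin n) :
    Integrable (fun x => Real.exp (c / (4 * γ) * tt n k ν i x ^ 2)) γ₁ := by
  unfold tt
  split_ifs
  · exact intble2 _ _ (bnn hc hγ) hν (blt hc hγ)
  · exact intble1 _ _ (blt hc hγ)

lemma tt_val (n k : ℕ) (c γ ν : ℝ) (hc : 0 < c) (hγ : c / 2 < γ) (hν : 0 ≤ ν) (i : Fin n) :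
    ∫ x, Real.exp (c / (4 * γ) * tt n k ν i x ^ 2) ∂γ₁ = if (i : ℕ) < n - k then I2 c γ ν else I1 c γ ν := by
  unfold tt
  split_ifs
  · exact val2 c γ ν hc hγ hν
  · exact val1 c γ ν hc hγ

lemma prod_val (n k : ℕ) (hk : k ≤ n) (a b : ℝ) :
    ∏ i : Fin n, (if (i : ℕ) < n - k then a else b) = a ^ (n - k) * b ^ k := by
  rw [Fin.prod_univ_eq_prod_range (fun i => if i < n - k then a else b) n,
    ← Finset.prod_range_mul_prod_Ico _ (Nat.sub_le n k)]
  congr 1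
  · rw [Finset.prod_congr rfl (fun i hi => if_pos (Finset.mem_range.1 hi))]; simp
  · rw [Finset.prod_congr rfl (fun i hi => if_neg (not_lt.2 (Finset.mem_Ico.1 hi).1))]
    simp; congr 1; omega

lemma TI (n k : ℕ) (c γ ν : ℝ) (hc : 0 < c) (hγ : c / 2 < γ) (hν : 0 ≤ ν) (hk : k ≤ n) :
    Integrable (fun h : Fin n → ℝ => Real.exp (c / (4 * γ) * ∑ i, tt n k ν i (h i) ^ 2)) (Measure.pi fun _ : Fin n => γ₁) ∧
    ∫ h : Fin n → ℝ, Real.exp (c / (4 * γ) * ∑ i, tt n k ν i (h i) ^ 2) ∂(Measure.pi fun _ : Fin n => γ₁) =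
      I2 c γ ν ^ (n - k) * I1 c γ ν ^ k := by
  have : ∀ h : Fin n → ℝ, Real.exp (c / (4 * γ) * ∑ i, tt n k ν i (h i) ^ 2) =
      ∏ i, Real.exp (c / (4 * γ) * tt n k ν i (h i) ^ 2) := by
    intro g; rw [← Real.exp_sum, Finset.mul_sum]
  simp only [this]
  constructor
  · exact Integrable.fintype_prod (f := fun (i : Fin n) x => Real.exp (c / (4 * γ) * tt n k ν i x ^ 2)) fun i => tt_int n k c γ ν hc hγ hν i
  · rw [integral_fintype_prod_eq_prod (𝕜 := ℝ) (fun (i : Fin n) (x : ℝ) => Real.exp (c / (4 * γ) * tt n k ν i x ^ 2))]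
    simp only [tt_val n k c γ ν hc hγ hν]
    exact prod_val n k hk _ _

lemma bad_n (c γ ν α β : ℝ) (hc : 0 < c) (hγ : c / 2 < γ) (hν : 0 ≤ ν) (hα : 0 < α) (hβ : 0 < β) (hβ1 : β < 1)
    (K : ℕ) (hK : 0 < K) (n m k : ℕ) (hn : 0 < n) (hm : α * n ≤ m) (hk : k ≤ n) (hk1 : β * n ≤ k) (hk2 : k ≤ β * n + 1) :
    matrixGaussian m n {A | ∃ w ∈ SS n k, ∀ k, ∑ j, A k j * w j = 0} ≤
      ENNReal.ofReal (2 * (K + 1) * Real.sqrt (2 * Real.pi) *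
        Real.exp (n * (c * γ - c ^ 2 / 2 + c * Isph c α + β * Real.log (I1 c γ ν) + (1 - β) * Real.log (I2 c γ ν)
          + c * (Real.sqrt α / K)) + 4 * c * Real.sqrt n + (Real.log (I1 c γ ν) + 9 / 2))) := by
  have hγ0 : 0 < γ := by linarith
  have hnr : (0:ℝ) < n := by exact_mod_cast hn
  obtain ⟨N, hN⟩ : ∃ N, N = Real.sqrt n := ⟨_, rfl⟩
  have hN0 : 0 < N := by rw [hN]; positivity
  have hN2 : (n:ℝ) = N ^ 2 := by rw [hN, Real.sq_sqrt hnr.le]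
  set T : (Fin n → ℝ) → ℝ := fun h => ∑ i, tt n k ν i (h i) ^ 2 with hT
  obtain ⟨hI, hV⟩ := TI n k c γ ν hc hγ hν hk
  set C := Real.exp (c * γ * N ^ 2 - c * N * (c * N) + c * N) with hC
  set f : (Fin m → ℝ) × (Fin n → ℝ) → ℝ := fun ω =>
    C * (Real.exp (-(c * Real.sqrt n) * Real.sqrt (∑ k, ω.1 k ^ 2)) * Real.exp (c / (4 * γ) * T ω.2)) with hf
  have hfi : Integrable f (μY m n) :=
    ((gr_int (m := m) (c * Real.sqrt n) (by positivity)).mul_prod hI).const_mul C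
  have hfv : ∫ ω, f ω ∂(μY m n) = C * ((∫ g : Fin m → ℝ, Real.exp (-(c * Real.sqrt n) * Real.sqrt (∑ k, g k ^ 2)) ∂(Measure.pi fun _ : Fin m => γ₁)) *
      (I2 c γ ν ^ (n - k) * I1 c γ ν ^ k)) := by
    rw [← hV, ← integral_prod_mul, ← integral_const_mul]
  have key := bad_bound (m := m) (SS n k) (SS_compact n k) (fun w hw => hw.1) (c * N) f hfi
    (fun ω => by positivity) (by
      rintro g h ⟨w, hw, hle⟩
      simp only [hf, hC]
      rw [← Real.exp_add, ← Real.exp_add]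
      refine Real.one_le_exp ?_
      have h1 := SS_pt n k ν hν w h hw
      have hTT : (∑ i, tt n k ν i (h i) ^ 2) = T h := rfl
      have hT0 : 0 ≤ T h := Finset.sum_nonneg fun i _ => sq_nonneg _
      rw [hTT] at h1
      have h2 : Real.sqrt (T h) ^ 2 = T h := Real.sq_sqrt hT0
      have h3 : c / (4 * γ) * T h + c * γ * N ^ 2 - c * N * Real.sqrt (T h) = c / (4 * γ) * (Real.sqrt (T h) - 2 * γ * N) ^ 2 := by
        rw [← h2]
        simp only [Real.sqrt_sq (Real.sqrt_nonneg (T h))]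
        field_simp; ring
      have h4 : 0 ≤ c / (4 * γ) * (Real.sqrt (T h) - 2 * γ * N) ^ 2 := by positivity
      have h5 : 0 ≤ c * N * (Real.sqrt (T h) - Real.sqrt (∑ k, g k ^ 2) - c * N + 1) :=
        mul_nonneg (by positivity) (by linarith)
      rw [← hN]
      nlinarith)
  have tl := tail_lb (c * N) (by positivity)
  set t := (Real.sqrt (2 * Real.pi))⁻¹ * Real.exp (-(c * N + 3) ^ 2 / 2) with ht
  have ht0 : 0 < t := by positivity
  have k2 := (mul_le_mul_right tl _).trans key
  rw [← ENNReal.le_div_iff_mul_le (Or.inl (by simpa using ht0)) (Or.inl ENNReal.ofReal_ne_top),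
    ← ENNReal.ofReal_div_of_pos ht0] at k2
  refine k2.trans (ENNReal.ofReal_le_ofReal ?_)
  rw [div_le_iff₀ ht0, hfv]
  have g1 := I1_ge c γ ν hc hγ
  have g2 := I2_ge c γ ν hc hγ hν
  have l1 := Real.log_nonneg g1
  have l2 := Real.log_nonneg g2
  have p1 : I1 c γ ν ^ k ≤ Real.exp ((β * n + 1) * Real.log (I1 c γ ν)) := by
    rw [← Real.exp_log (by linarith : 0 < I1 c γ ν), ← Real.exp_nat_mul, Real.log_exp]
    exact Real.exp_le_exp.2 (mul_le_mul_of_nonneg_right hk2 l1)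
  have p2 : I2 c γ ν ^ (n - k) ≤ Real.exp ((1 - β) * n * Real.log (I2 c γ ν)) := by
    rw [← Real.exp_log (by linarith : 0 < I2 c γ ν), ← Real.exp_nat_mul, Real.log_exp, Nat.cast_sub hk]
    exact Real.exp_le_exp.2 (mul_le_mul_of_nonneg_right (by linarith) l2)
  have ch := chi_bound c α hc hα K hK n m hn hm
  have hprod : (∫ g : Fin m → ℝ, Real.exp (-(c * Real.sqrt n) * Real.sqrt (∑ k, g k ^ 2)) ∂(Measure.pi fun _ : Fin m => γ₁)) *
      (I2 c γ ν ^ (n - k) * I1 c γ ν ^ k) ≤ ((K + 1) * Real.exp (n * (c * Isph c α + c * (Real.sqrt α / K)))) *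
      (Real.exp ((1 - β) * n * Real.log (I2 c γ ν)) * Real.exp ((β * n + 1) * Real.log (I1 c γ ν))) := by
    have : 0 < I1 c γ ν := by linarith
    have : 0 < I2 c γ ν := by linarith
    gcongr
  have := mul_le_mul_of_nonneg_left hprod (by positivity : 0 ≤ 2 * C)
  rw [mul_assoc 2 C] at this
  refine this.trans (le_of_eq ?_)
  rw [ht, hC, ← hN, hN2]
  have q : Real.sqrt (2 * Real.pi) ≠ 0 := by positivity
  have : ∀ E1 E2 E3 E4 E5 E6 : ℝ, E1 + E2 + (E3 + E4) = E5 + E6 → 2 * Real.exp E1 * ((K + 1) * Real.exp E2 * (Real.exp E3 * Real.exp E4)) =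
      2 * (K + 1) * Real.sqrt (2 * Real.pi) * Real.exp E5 * ((Real.sqrt (2 * Real.pi))⁻¹ * Real.exp E6) := by
    intro E1 E2 E3 E4 E5 E6 h
    have h' : Real.exp E1 * Real.exp E2 * (Real.exp E3 * Real.exp E4) = Real.exp E5 * Real.exp E6 := by
      simp only [← Real.exp_add, h]
    field_simp
    linear_combination h'
  apply this
  ring

lemma bad_sub (m n k : ℕ) :
    {A : Fin m → Fin n → ℝ | ∀ x : Fin n → ℝ, (∀ i : Fin n, (i : ℕ) < n - k → x i = 0) → UniqueL1Min A x}ᶜ ⊆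
      {A | ∃ w ∈ SS n k, ∀ k, ∑ j, A k j * w j = 0} := by
  intro A hA
  simp only [Set.mem_compl_iff, Set.mem_ofPred_eq] at hA
  unfold UniqueL1Min at hA
  push Not at hA
  obtain ⟨x, hx, z, hz, hne, hle⟩ := hA
  set d := z - x with hd
  have hd0 : d ≠ 0 := sub_ne_zero.2 hne
  have hpos : 0 < ∑ i, d i ^ 2 := by
    obtain ⟨i, hi⟩ := Function.ne_iff.1 hd0
    exact Finset.sum_pos' (fun i _ => sq_nonneg _) ⟨i, Finset.mem_univ i, by simp at hi; positivity⟩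
  set r := Real.sqrt (∑ i, d i ^ 2) with hr
  have hr0 : 0 < r := by positivity
  have hr2 : r ^ 2 = ∑ i, d i ^ 2 := Real.sq_sqrt hpos.le
  have hAd : ∀ a, ∑ j, A a j * d j = 0 := by
    intro a
    simp only [hd, Pi.sub_apply, mul_sub, Finset.sum_sub_distrib, hz a, sub_self]
  have hsg : ∑ i : Fin n, (if (i : ℕ) < n - k then (1:ℝ) else -1) * |d i| ≤ 0 := by
    have : ∀ i : Fin n, (if (i : ℕ) < n - k then (1:ℝ) else -1) * |d i| ≤ |z i| - |x i| := by
      intro i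
      split_ifs with h
      · simp [hd, hx i h]
      · have : |x i| - |z i| ≤ |d i| := by
          rw [hd, Pi.sub_apply, abs_sub_comm]; exact abs_sub_abs_le_abs_sub _ _
        linarith
    have := Finset.sum_le_sum (s := Finset.univ) fun i _ => this i
    rw [Finset.sum_sub_distrib] at this
    linarith
  refine ⟨fun i => r⁻¹ * d i, ⟨?_, ?_⟩, ?_⟩
  · simp only [mul_pow]
    rw [← Finset.mul_sum, ← hr2]; field_simp
  · have : ∀ i : Fin n, (if (i : ℕ) < n - k then (1:ℝ) else -1) * |r⁻¹ * d i| =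
        r⁻¹ * ((if (i : ℕ) < n - k then (1:ℝ) else -1) * |d i|) := by
      intro i; rw [abs_mul, abs_of_pos (inv_pos.2 hr0)]; ring
    simp only [this]
    rw [← Finset.mul_sum]
    exact mul_nonpos_of_nonneg_of_nonpos (inv_pos.2 hr0).le hsg
  · intro a
    have : ∀ j, A a j * (r⁻¹ * d j) = r⁻¹ * (A a j * d j) := fun j => by ring
    simp only [this]
    rw [← Finset.mul_sum, hAd a, mul_zero]

theorem sectional_threshold_lifted_lower_bound
    (α β : ℝ) (hα : α ∈ Set.Ioo (0 : ℝ) 1) (hβ : β ∈ Set.Ioo (0 : ℝ) 1)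
    (hcond : ∃ c : ℝ, 0 < c ∧ -c / 2 + Isec c β + Isph c α < 0) :
    ∃ ε > (0 : ℝ), ∃ N : ℕ, ∀ n ≥ N,
      1 - ENNReal.ofReal (Real.exp (-ε * n)) ≤
        matrixGaussian (⌈α * n⌉₊) n
          {A | ∀ x : Fin n → ℝ,
            (∀ i : Fin n, (i : ℕ) < n - ⌈β * n⌉₊ → x i = 0) → UniqueL1Min A x} := by
  obtain ⟨c, hc, hlt⟩ := hcond
  have hlt' : Isec c β < c / 2 - Isph c α := by linarith
  unfold Isec at hlt'
  obtain ⟨v, ⟨γ, ν, hγ, hν, rfl⟩, hv⟩ := (by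
    refine exists_lt_of_csInf_lt ?_ hlt'
    exact ⟨_, c, 0, by linarith, le_rfl, rfl⟩)
  obtain ⟨E0, hE0⟩ : ∃ E0, E0 = c * γ - c ^ 2 / 2 + c * Isph c α + β * Real.log (I1 c γ ν) + (1 - β) * Real.log (I2 c γ ν) := ⟨_, rfl⟩
  have hE : E0 < 0 := by
    have h1 := mul_lt_mul_of_pos_left hv hc
    have h2 : c * (γ + β / c * Real.log (I1 c γ ν) + (1 - β) / c * Real.log (I2 c γ ν)) =
        c * γ + β * Real.log (I1 c γ ν) + (1 - β) * Real.log (I2 c γ ν) := by field_simp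
    rw [h2] at h1
    rw [hE0]; nlinarith
  obtain ⟨K, hK⟩ := exists_nat_gt (max 1 (c * Real.sqrt α / (-E0 / 2)))
  have hK1 : (1:ℝ) < K := (le_max_left _ _).trans_lt hK
  have hK0 : 0 < K := by
    have : (0:ℝ) < K := by linarith
    exact_mod_cast this
  have hK2 : c * (Real.sqrt α / K) ≤ -E0 / 2 := by
    have h := (le_max_right _ _).trans_lt hK
    rw [div_lt_iff₀ (by linarith)] at h
    rw [← mul_div_assoc, div_le_iff₀ (by linarith)]
    linarith
  obtain ⟨D, hD⟩ : ∃ D, D = Real.log (2 * (K + 1) * Real.sqrt (2 * Real.pi)) + (Real.log (I1 c γ ν) + 9 / 2) := ⟨_, rfl⟩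
  refine ⟨-E0 / 4, by linarith, ?_⟩
  obtain ⟨N, hN⟩ := exists_nat_gt (max 1 (((4 * c + |D|) / (-E0 / 4)) ^ 2))
  refine ⟨N, fun n hn => ?_⟩
  have hnN : (N:ℝ) ≤ n := by exact_mod_cast hn
  have hn1 : (1:ℝ) < n := (le_max_left _ _).trans_lt (hN.trans_le hnN)
  have hn0 : 0 < n := by
    have : (0:ℝ) < n := by linarith
    exact_mod_cast this
  have hk : ⌈β * n⌉₊ ≤ n := Nat.ceil_le.2 (by nlinarith [hβ.2])
  have hbad := bad_n c γ ν α β hc hγ hν hα.1 hβ.1 hβ.2 K hK0 n ⌈α * n⌉₊ ⌈β * n⌉₊ hn0 (Nat.le_ceil _) hk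
    (Nat.le_ceil _) (Nat.ceil_lt_add_one (by have := hβ.1; positivity)).le
  have hfin : 2 * (K + 1) * Real.sqrt (2 * Real.pi) *
        Real.exp (n * (c * γ - c ^ 2 / 2 + c * Isph c α + β * Real.log (I1 c γ ν) + (1 - β) * Real.log (I2 c γ ν)
          + c * (Real.sqrt α / K)) + 4 * c * Real.sqrt n + (Real.log (I1 c γ ν) + 9 / 2)) ≤ Real.exp (-(-E0 / 4) * n) := by
    rw [← hE0]
    nth_rewrite 1 [← Real.exp_log (by positivity : 0 < 2 * (K + 1) * Real.sqrt (2 * Real.pi))]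
    rw [← Real.exp_add]
    refine Real.exp_le_exp.2 ?_
    have s2 : Real.sqrt n ^ 2 = n := Real.sq_sqrt (by linarith)
    have s1 : 1 ≤ Real.sqrt n := Real.one_le_sqrt.2 hn1.le
    have s3 : (4 * c + |D|) / (-E0 / 4) ≤ Real.sqrt n :=
      Real.le_sqrt_of_sq_le ((le_max_right _ _).trans (hN.le.trans hnN))
    rw [div_le_iff₀ (by linarith)] at s3
    have s4 : 4 * c * Real.sqrt n + D ≤ -E0 / 4 * n := by
      have := mul_le_mul_of_nonneg_right s3 (by linarith : 0 ≤ Real.sqrt n)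
      nlinarith [le_abs_self D, abs_nonneg D]
    have := mul_le_mul_of_nonneg_left hK2 (by linarith : (0:ℝ) ≤ n)
    nlinarith
  set G := {A : Fin ⌈α * n⌉₊ → Fin n → ℝ | ∀ x : Fin n → ℝ,
            (∀ i : Fin n, (i : ℕ) < n - ⌈β * n⌉₊ → x i = 0) → UniqueL1Min A x} with hG
  have hc1 : matrixGaussian ⌈α * n⌉₊ n Gᶜ ≤ ENNReal.ofReal (Real.exp (-(-E0 / 4) * n)) :=
    (measure_mono (bad_sub _ n _)).trans (hbad.trans (ENNReal.ofReal_le_ofReal hfin))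
  rw [tsub_le_iff_right]
  calc (1 : ENNReal) = matrixGaussian ⌈α * n⌉₊ n Set.univ := measure_univ.symm
    _ = matrixGaussian ⌈α * n⌉₊ n (G ∪ Gᶜ) := by rw [Set.union_compl_self]
    _ ≤ matrixGaussian ⌈α * n⌉₊ n G + matrixGaussian ⌈α * n⌉₊ n Gᶜ := measure_union_le _ _
    _ ≤ _ := by gcongr
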